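/- arXiv:1301.5613 — 4 statements merged into one kernel-verified Lean document; each statement's English description precedes it below -/
import Mathlib

section
/- Let k be a field, A = ⊕_{n≥0} A_n an ℕ-graded commutative domain which is a finitely generated k-algebra such that A_0 is a finite-dimensional k-vector space and A is generated by A_1 as an A_0-algebra, and let L = ⊕_{n≥0} L_n be a graded k-subalgebra of A (L_n ⊆ A_n) with Kodaira–Iitaka dimension κ = κ(L) ≥ 0 and index m = m(L). For p ≥ 1 let k[L_{pm}] denote the k-subalgebra of A generated by L_{pm}. Then for all sufficiently large p the limit c_p := lim_{n→∞} dim_k (k[L_{pm}])_{npm}/n^κ exists, and lim_{p→∞} c_p/p^κ = lim_{n→∞} dim_k L_{nm}/n^κ (both outer limits exist). -/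
open Filter Topology

open MonomialOrder in
theorem exists_valuation_of_mvPolynomial.{u, v} {k : Type u} [Field k] {A : Type v} [CommRing A] [IsDomain A]
    {N : ℕ} (g : MvPolynomial (Fin N) k →+* A) (hg : Function.Injective g) :
    ∃ (Γ₀ : Type v) (_ : LinearOrderedCommGroupWithZero Γ₀) (w : Valuation A Γ₀),
      (∀ f, w f = 0 ↔ f = 0) ∧
      ∀ a b : MvPolynomial (Fin N) k, a ≠ 0 → b ≠ 0 →
        (w (g a) = w (g b) ↔ (lex (σ := Fin N)).degree a = (lex (σ := Fin N)).degree b) ∧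
        (w (g a) < w (g b) ↔ (lex (σ := Fin N)).degree a ≺[lex] (lex (σ := Fin N)).degree b) := by
  let o : MonomialOrder (Fin N) := lex
  let F := FractionRing A
  let i : MvPolynomial (Fin N) k →+* F := (algebraMap A F).comp g
  have hi : Function.Injective i := (IsFractionRing.injective A F).comp hg
  have hi0 : ∀ {a}, a ≠ 0 → i a ≠ 0 := fun {a} h => by
    rwa [Ne, map_eq_zero_iff i hi]
  have lc0 : ∀ {b : MvPolynomial (Fin N) k}, b ≠ 0 → b.coeff (o.degree b) ≠ 0 := fun {b} h =>
    o.leadingCoeff_ne_zero_iff.2 h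
  let R : Subring F :=
    { carrier := {z | ∃ a b, b ≠ 0 ∧ z * i b = i a ∧ o.degree a ≼[o] o.degree b}
      mul_mem' := by
        rintro x y ⟨a, b, hb, h, hd⟩ ⟨a', b', hb', h', hd'⟩
        refine ⟨a * a', b * b', mul_ne_zero hb hb', ?_, ?_⟩
        · rw [map_mul, map_mul, ← h, ← h']; ring
        · rw [o.degree_mul hb hb', map_add]
          refine o.degree_mul_le.trans ?_
          rw [map_add]; exact add_le_add hd hd'
      one_mem' := ⟨1, 1, one_ne_zero, by simp, le_rfl⟩
      add_mem' := by
        rintro x y ⟨a, b, hb, h, hd⟩ ⟨a', b', hb', h', hd'⟩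
        refine ⟨a * b' + a' * b, b * b', mul_ne_zero hb hb', ?_, ?_⟩
        · simp only [map_mul, map_add, ← h, ← h']; ring
        · rw [o.degree_mul hb hb', map_add]
          refine o.degree_add_le.trans (sup_le (o.degree_mul_le.trans ?_) (o.degree_mul_le.trans ?_))
          · rw [map_add]; exact add_le_add hd le_rfl
          · rw [map_add, add_comm]; exact add_le_add le_rfl hd'
      zero_mem' := ⟨0, 1, one_ne_zero, by simp, by simp⟩
      neg_mem' := by
        rintro x ⟨a, b, hb, h, hd⟩
        exact ⟨-a, b, hb, by rw [neg_mul, h, map_neg], by simpa using hd⟩ }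
  let I : Ideal R :=
    { carrier := {z | ∃ a b, b ≠ 0 ∧ (z : F) * i b = i a ∧ o.degree a ≼[o] o.degree b ∧
        a.coeff (o.degree b) = 0}
      add_mem' := by
        rintro x y ⟨a, b, hb, h, hd, hc⟩ ⟨a', b', hb', h', hd', hc'⟩
        refine ⟨a * b' + a' * b, b * b', mul_ne_zero hb hb', ?_, ?_, ?_⟩
        · simp only [map_mul, map_add, ← h, ← h']; push_cast; ring
        · rw [o.degree_mul hb hb', map_add]
          refine o.degree_add_le.trans (sup_le (o.degree_mul_le.trans ?_) (o.degree_mul_le.trans ?_))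
          · rw [map_add]; exact add_le_add hd le_rfl
          · rw [map_add, add_comm]; exact add_le_add le_rfl hd'
        · rw [o.degree_mul hb hb', MvPolynomial.coeff_add,
            o.coeff_mul_of_add_of_degree_le hd le_rfl, add_comm (o.degree b),
            o.coeff_mul_of_add_of_degree_le hd' le_rfl, hc, hc']; simp
      zero_mem' := ⟨0, 1, one_ne_zero, by simp, by simp, by simp⟩
      smul_mem' := by
        rintro ⟨x, a, b, hb, h, hd⟩ y ⟨a', b', hb', h', hd', hc'⟩
        refine ⟨a * a', b * b', mul_ne_zero hb hb', ?_, ?_, ?_⟩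
        · simp only [map_mul, ← h, ← h', smul_eq_mul, Subring.coe_mul]; ring
        · rw [o.degree_mul hb hb', map_add]
          refine o.degree_mul_le.trans ?_
          rw [map_add]; exact add_le_add hd hd'
        · rw [o.degree_mul hb hb', o.coeff_mul_of_add_of_degree_le hd hd', hc', mul_zero] }
  have hI : I ≠ ⊤ := by
    rw [Ne, Ideal.eq_top_iff_one]
    rintro ⟨a, b, hb, h, hd, hc⟩
    have : b = a := hi (by simpa using h)
    subst this
    exact lc0 hb hc
  obtain ⟨B, hRB, hIB⟩ := Ideal.image_subset_nonunits_valuationSubring I hI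
  have hle : ∀ a b, a ≠ 0 → b ≠ 0 → o.degree a ≼[o] o.degree b →
      B.valuation (i a) ≤ B.valuation (i b) := by
    intro a b ha hb h
    have : i a / i b ∈ B := hRB ⟨a, b, hb, div_mul_cancel₀ _ (hi0 hb), h⟩
    rw [← ValuationSubring.valuation_le_one_iff, map_div₀] at this
    exact (div_le_one₀ (zero_lt_iff.2 ((map_ne_zero _).2 (hi0 hb)))).1 this
  have hlt : ∀ a b, a ≠ 0 → b ≠ 0 → o.degree a ≺[o] o.degree b →
      B.valuation (i a) < B.valuation (i b) := by
    intro a b ha hb h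
    have hR : i a / i b ∈ R := ⟨a, b, hb, div_mul_cancel₀ _ (hi0 hb), h.le⟩
    have : i a / i b ∈ B.nonunits := hIB ⟨⟨_, hR⟩, ⟨a, b, hb, div_mul_cancel₀ _ (hi0 hb), h.le, ?_⟩, rfl⟩
    · rw [ValuationSubring.mem_nonunits_iff, map_div₀] at this
      exact (div_lt_one₀ (zero_lt_iff.2 ((map_ne_zero _).2 (hi0 hb)))).1 this
    · exact o.coeff_eq_zero_of_lt h
  refine ⟨_, inferInstance, B.valuation.comap (algebraMap A F), fun f => ?_, fun a b ha hb => ?_⟩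
  · rw [Valuation.comap_apply, map_eq_zero,
      map_eq_zero_iff _ (IsFractionRing.injective A F)]
  · change (B.valuation (i a) = B.valuation (i b) ↔ o.degree a = o.degree b) ∧
      (B.valuation (i a) < B.valuation (i b) ↔ o.degree a ≺[o] o.degree b)
    rcases lt_trichotomy (o.toSyn (o.degree a)) (o.toSyn (o.degree b)) with h | h | h
    · exact ⟨⟨fun e => absurd e (hlt a b ha hb h).ne, fun e => absurd (congrArg o.toSyn e) h.ne⟩,
        ⟨fun _ => h, fun _ => hlt a b ha hb h⟩⟩
    · have := le_antisymm (hle a b ha hb h.le) (hle b a hb ha h.ge)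
      exact ⟨⟨fun _ => o.toSyn.injective h, fun _ => this⟩,
        ⟨fun e => absurd this e.ne, fun e => absurd h e.ne⟩⟩
    · have := hlt b a hb ha h
      exact ⟨⟨fun e => absurd e this.ne', fun e => absurd (congrArg o.toSyn e) h.ne'⟩,
        ⟨fun e => absurd e this.not_gt, fun e => absurd e h.not_gt⟩⟩
theorem Valuation.exists_map_sum_eq {A Γ₀ ι : Type*} [CommRing A] [LinearOrderedCommGroupWithZero Γ₀]
    (w : Valuation A Γ₀) (s : Finset ι) (t : ι → A) (hs : s.Nonempty)
    (hinj : Set.InjOn (fun i => w (t i)) s) : ∃ i ∈ s, w (∑ j ∈ s, t j) = w (t i) := by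
  classical
  obtain ⟨i, hi, hmax⟩ := s.exists_max_image (fun i => w (t i)) hs
  refine ⟨i, hi, ?_⟩
  rw [← Finset.add_sum_erase s t hi]
  rcases (s.erase i).eq_empty_or_nonempty with h | ⟨j, hj⟩
  · simp [h]
  · refine w.map_add_eq_of_lt_left (w.map_sum_lt ?_ fun l hl => ?_)
    · have := hmax j (Finset.mem_of_mem_erase hj)
      have hne : w (t j) ≠ w (t i) := fun e =>
        Finset.ne_of_mem_erase hj (hinj (Finset.mem_of_mem_erase hj) hi e)
      exact (lt_of_le_of_lt zero_le (lt_of_le_of_ne this hne)).ne'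
    · exact lt_of_le_of_ne (hmax l (Finset.mem_of_mem_erase hl)) fun e =>
        Finset.ne_of_mem_erase hl (hinj (Finset.mem_of_mem_erase hl) hi e)

theorem Valuation.exists_ne_map_eq_of_sum_eq_zero {A Γ₀ ι : Type*} [CommRing A]
    [LinearOrderedCommGroupWithZero Γ₀]
    (w : Valuation A Γ₀) (hw : ∀ f, w f = 0 ↔ f = 0) (s : Finset ι) (t : ι → A)
    (h0 : ∑ j ∈ s, t j = 0) (hne : ∃ i ∈ s, t i ≠ 0) :
    ∃ i ∈ s, ∃ j ∈ s, i ≠ j ∧ t i ≠ 0 ∧ t j ≠ 0 ∧ w (t i) = w (t j) := by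
  classical
  by_contra! hcon
  obtain ⟨i, hi, hti⟩ := hne
  obtain ⟨j, hj, h⟩ := w.exists_map_sum_eq (s.filter fun i => t i ≠ 0) t
    ⟨i, Finset.mem_filter.2 ⟨hi, hti⟩⟩ (by
      intro a ha b hb hab
      simp only [Finset.coe_filter, Set.mem_ofPred_eq] at ha hb
      by_contra hne
      exact hcon a ha.1 b hb.1 hne ha.2 hb.2 hab)
  rw [Finset.sum_filter_ne_zero, h0, map_zero] at h
  exact (Finset.mem_filter.1 hj).2 ((hw _).1 h.symm)

/-- Multiplication by `f` acts on the family `e` through a matrix of polynomials of total degree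
at most `t`. -/
def ActsWithDegree {P A : Type*} [CommSemiring P] [CommRing A] (deg : P → ℕ) {r : ℕ}
    (g : P →+* A) (e : Fin r → A) (t : ℕ) (f : A) : Prop :=
  ∃ M : Matrix (Fin r) (Fin r) P, (∀ i j, deg (M i j) ≤ t) ∧ ∀ i, f * e i = ∑ j, g (M i j) * e j

section ActsWithDegree

variable {k A : Type*} [Field k] [CommRing A] {N r : ℕ}
  (g : MvPolynomial (Fin N) k →+* A) (e : Fin r → A)

theorem ActsWithDegree.mono {s t : ℕ} {f : A}
    (h : ActsWithDegree MvPolynomial.totalDegree g e s f) (hst : s ≤ t) :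
    ActsWithDegree MvPolynomial.totalDegree g e t f := by
  obtain ⟨M, hM, h⟩ := h
  exact ⟨M, fun i j => (hM i j).trans hst, h⟩

theorem ActsWithDegree.mul {s t : ℕ} {f f' : A}
    (h : ActsWithDegree MvPolynomial.totalDegree g e s f)
    (h' : ActsWithDegree MvPolynomial.totalDegree g e t f') :
    ActsWithDegree MvPolynomial.totalDegree g e (s + t) (f * f') := by
  obtain ⟨M, hM, h⟩ := h
  obtain ⟨M', hM', h'⟩ := h'
  refine ⟨M' * M, fun i j => ?_, fun i => ?_⟩
  · rw [Matrix.mul_apply]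
    refine MvPolynomial.totalDegree_finsetSum_le fun l _ => ?_
    refine (MvPolynomial.totalDegree_mul _ _).trans ?_
    have := hM' i l; have := hM l j; omega
  · rw [mul_assoc, h', Finset.mul_sum]
    simp_rw [mul_left_comm f, h, Finset.mul_sum, Matrix.mul_apply, map_sum, Finset.sum_mul]
    rw [Finset.sum_comm]
    simp only [map_mul, mul_assoc]

theorem ActsWithDegree.add {t : ℕ} {f f' : A}
    (h : ActsWithDegree MvPolynomial.totalDegree g e t f)
    (h' : ActsWithDegree MvPolynomial.totalDegree g e t f') :
    ActsWithDegree MvPolynomial.totalDegree g e t (f + f') := by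
  obtain ⟨M, hM, h⟩ := h
  obtain ⟨M', hM', h'⟩ := h'
  refine ⟨M + M', fun i j => ?_, fun i => ?_⟩
  · exact (MvPolynomial.totalDegree_add _ _).trans (max_le (hM i j) (hM' i j))
  · simp [add_mul, h, h', Finset.sum_add_distrib]

theorem ActsWithDegree.zero (t : ℕ) : ActsWithDegree MvPolynomial.totalDegree g e t 0 :=
  ⟨0, fun i j => by simp, fun i => by simp⟩

theorem ActsWithDegree.of_coeff (c : k) (t : ℕ) :
    ActsWithDegree MvPolynomial.totalDegree g e t (g (MvPolynomial.C c)) := by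
  classical
  refine ⟨Matrix.diagonal fun _ => MvPolynomial.C c, fun i j => ?_, fun i => ?_⟩
  · rw [Matrix.diagonal_apply]; split_ifs <;> simp
  · rw [Finset.sum_eq_single i]
    · simp
    · intro j _ hj; simp [Matrix.diagonal_apply_ne' _ hj]
    · simp

theorem Polynomial.totalDegree_coeff_prod_le {ι : Type*} (s : Finset ι) (t : ℕ)
    (q : ι → Polynomial (MvPolynomial (Fin N) k))
    (hq : ∀ i ∈ s, ∀ j, ((q i).coeff j).totalDegree ≤ t) (j : ℕ) :
    ((∏ i ∈ s, q i).coeff j).totalDegree ≤ s.card * t := by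
  classical
  induction s using Finset.induction_on generalizing j with
  | empty =>
    rw [Finset.prod_empty, Polynomial.coeff_one]
    split_ifs <;> simp
  | insert a s ha ih =>
    rw [Finset.prod_insert ha, Polynomial.coeff_mul]
    refine MvPolynomial.totalDegree_finsetSum_le fun l _ => ?_
    refine (MvPolynomial.totalDegree_mul _ _).trans ?_
    have h1 := hq a (Finset.mem_insert_self _ _) l.1
    have h2 := ih (fun i hi => hq i (Finset.mem_insert_of_mem hi)) l.2
    rw [Finset.card_insert_of_notMem ha]
    nlinarith

theorem Matrix.totalDegree_coeff_charpoly_le (M : Matrix (Fin r) (Fin r) (MvPolynomial (Fin N) k))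
    (t : ℕ) (hM : ∀ i j, (M i j).totalDegree ≤ t) (j : ℕ) :
    (M.charpoly.coeff j).totalDegree ≤ r * t := by
  rw [Matrix.charpoly, Matrix.det_apply, Polynomial.finsetSum_coeff]
  refine MvPolynomial.totalDegree_finsetSum_le fun σ _ => ?_
  have h := Polynomial.totalDegree_coeff_prod_le Finset.univ t (fun i => M.charmatrix (σ i) i)
    (fun i _ l => by
      rw [Matrix.charmatrix_apply, Polynomial.coeff_sub, Polynomial.coeff_C]
      refine (MvPolynomial.totalDegree_sub _ _).trans (max_le ?_ ?_)
      · rw [Matrix.diagonal_apply]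
        split_ifs
        · rw [Polynomial.coeff_X]; split_ifs <;> simp
        · simp
      · split_ifs
        · exact hM _ _
        · simp) j
  rw [Finset.card_univ, Fintype.card_fin] at h
  rcases Int.units_eq_one_or (Equiv.Perm.sign σ) with hs | hs
  · rw [hs, one_smul]; exact h
  · rw [hs, Units.neg_smul, one_smul, Polynomial.coeff_neg, MvPolynomial.totalDegree_neg]; exact h

theorem ActsWithDegree.exists_monic [IsDomain A] (he : e ≠ 0) {t : ℕ} {f : A}
    (h : ActsWithDegree MvPolynomial.totalDegree g e t f) :
    ∃ q : Polynomial (MvPolynomial (Fin N) k), q.Monic ∧ q.natDegree = r ∧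
      (∀ j, (q.coeff j).totalDegree ≤ r * t) ∧ q.eval₂ g f = 0 := by
  obtain ⟨M, hM, h⟩ := h
  refine ⟨M.charpoly, M.charpoly_monic, by simp [Matrix.charpoly_natDegree_eq_dim],
    M.totalDegree_coeff_charpoly_le t hM, ?_⟩
  rw [Polynomial.eval₂_eq_eval_map, ← Matrix.charpoly_map, Matrix.eval_charpoly]
  rw [← Matrix.exists_mulVec_eq_zero_iff]
  refine ⟨e, he, ?_⟩
  rw [Matrix.sub_mulVec]
  ext i
  have := h i
  simp [Matrix.mulVec, dotProduct, Matrix.scalar_apply, ← this]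

end ActsWithDegree

theorem ActsWithDegree.exists_of_span {k A : Type*} [Field k] [CommRing A] {N r : ℕ}
    (g : MvPolynomial (Fin N) k →+* A) (e : Fin r → A)
    (hspan : ∀ f, ∃ c : Fin r → MvPolynomial (Fin N) k, f = ∑ i, g (c i) * e i) (f : A) :
    ∃ t, ActsWithDegree MvPolynomial.totalDegree g e t f := by
  choose c hc using fun i => hspan (f * e i)
  refine ⟨∑ i, ∑ j, (c i j).totalDegree, c, fun i j => ?_, hc⟩
  exact (Finset.single_le_sum (f := fun j => (c i j).totalDegree) (fun _ _ => Nat.zero_le _)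
    (Finset.mem_univ j)).trans (Finset.single_le_sum
      (f := fun i => ∑ j, (c i j).totalDegree) (fun _ _ => Nat.zero_le _) (Finset.mem_univ i))

theorem exists_actsWithDegree_graded {k A : Type*} [Field k] [CommRing A] [Algebra k A]
    (𝒜 : ℕ → Submodule k A) [GradedAlgebra 𝒜] (hFT : Algebra.FiniteType k A)
    (hA0 : FiniteDimensional k (𝒜 0)) {N r : ℕ}
    (g : MvPolynomial (Fin N) k →ₐ[k] A) (e : Fin r → A)
    (hspan : ∀ f, ∃ c : Fin r → MvPolynomial (Fin N) k, f = ∑ i, g (c i) * e i) :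
    ∃ C, ∀ n, ∀ f ∈ 𝒜 n, ActsWithDegree MvPolynomial.totalDegree (g : MvPolynomial (Fin N) k →+* A) e (C * (n + 1)) f := by
  classical
  set B := ActsWithDegree MvPolynomial.totalDegree (g : MvPolynomial (Fin N) k →+* A) e with hB
  have hex : ∀ f, ∃ t, B t f := ActsWithDegree.exists_of_span _ e hspan
  have hsmul : ∀ (c : k) t f, B t f → B t (c • f) := by
    intro c t f h
    have := (ActsWithDegree.of_coeff (g : MvPolynomial (Fin N) k →+* A) e c 0).mul _ e h
    rw [zero_add] at this
    rw [Algebra.smul_def]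
    convert this using 2
    exact (g.commutes c).symm
  have hA0' : ∃ t, ∀ a ∈ 𝒜 0, B t a := by
    obtain ⟨s, hs⟩ := (Submodule.fg_iff_finiteDimensional _).2 hA0
    choose T hT using hex
    refine ⟨s.sup T, fun a ha => ?_⟩
    rw [← hs] at ha
    induction ha using Submodule.span_induction with
    | mem x hx => exact (hT x).mono _ e (Finset.le_sup hx)
    | zero => exact ActsWithDegree.zero _ e _
    | add x y _ _ hx hy => exact hx.add _ e hy
    | smul c x _ hx => exact hsmul c _ _ hx
  obtain ⟨t₀, ht₀⟩ := hA0'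
  obtain ⟨s, hs⟩ := hFT.out
  have hC : ∃ C, ∀ y ∈ s, ∀ j, B C (DirectSum.decompose 𝒜 y j : A) := by
    choose T hT using hex
    refine ⟨s.sup fun y => (DirectSum.decompose 𝒜 y).support.sup
      fun j => T (DirectSum.decompose 𝒜 y j : A), fun y hy j => ?_⟩
    by_cases hj : j ∈ (DirectSum.decompose 𝒜 y).support
    · refine (hT _).mono _ e ?_
      exact (Finset.le_sup (f := fun j => T (DirectSum.decompose 𝒜 y j : A)) hj).trans
        (Finset.le_sup (f := fun y => (DirectSum.decompose 𝒜 y).support.sup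
          fun j => T (DirectSum.decompose 𝒜 y j : A)) hy)
    · rw [DFinsupp.notMem_support_iff.1 hj]
      exact ActsWithDegree.zero _ e _
  obtain ⟨C, hC⟩ := hC
  let E : ℕ → AddSubmonoid A := fun n =>
    AddSubmonoid.closure {x | ∃ a ∈ 𝒜 0, ∃ y, B (C * n) y ∧ x = a * y}
  have hE0 : ∀ n, ∀ a ∈ 𝒜 0, ∀ x ∈ E n, a * x ∈ E n := by
    intro n a ha x hx
    induction hx using AddSubmonoid.closure_induction with
    | mem x hx =>
      obtain ⟨b, hb, y, hy, rfl⟩ := hx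
      refine AddSubmonoid.subset_closure ⟨a * b, ?_, y, hy, by ring⟩
      simpa using SetLike.mul_mem_graded ha hb
    | zero => simp
    | add x y _ _ hx hy => rw [mul_add]; exact add_mem hx hy
  have hE : ∀ n j, j ≠ 0 → ∀ h, B C h → ∀ x ∈ E n, h * x ∈ E (j + n) := by
    intro n j hj h hh x hx
    induction hx using AddSubmonoid.closure_induction with
    | mem x hx =>
      obtain ⟨b, hb, y, hy, rfl⟩ := hx
      refine AddSubmonoid.subset_closure ⟨b, hb, h * y, ?_, by ring⟩
      refine (hh.mul _ e hy).mono _ e ?_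
      have : 1 ≤ j := Nat.one_le_iff_ne_zero.2 hj
      nlinarith
    | zero => simp
    | add x y _ _ hx hy => rw [mul_add]; exact add_mem hx hy
  let Q : Set A := {f | ∀ n, (DirectSum.decompose 𝒜 f n : A) ∈ E n}
  have hQadd : ∀ x ∈ Q, ∀ y ∈ Q, x + y ∈ Q := fun x hx y hy n => by
    rw [DirectSum.decompose_add]; exact add_mem (hx n) (hy n)
  have hQ0 : (0 : A) ∈ Q := fun n => by simp
  have hQh : ∀ j, ∀ h ∈ 𝒜 j, (∀ n, ∀ x ∈ E n, h * x ∈ E (j + n)) → ∀ x ∈ Q, h * x ∈ Q := by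
    intro j h hh hmul x hx n
    by_cases hjn : j ≤ n
    · rw [DirectSum.coe_decompose_mul_of_left_mem_of_le 𝒜 hh hjn]
      have := hmul (n - j) _ (hx (n - j))
      rwa [Nat.add_sub_cancel' hjn] at this
    · rw [DirectSum.coe_decompose_mul_of_left_mem_of_not_le 𝒜 hh hjn]
      exact zero_mem _
  have h1 : (1 : A) ∈ Q := by
    intro n
    by_cases hn : n = 0
    · subst hn
      refine AddSubmonoid.subset_closure ⟨1, SetLike.one_mem_graded 𝒜, 1, ?_, ?_⟩
      · simpa using ActsWithDegree.of_coeff (g : MvPolynomial (Fin N) k →+* A) e 1 (C * 0)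
      · rw [DirectSum.decompose_of_mem_same 𝒜 (SetLike.one_mem_graded 𝒜), one_mul]
    · rw [DirectSum.decompose_of_mem_ne 𝒜 (SetLike.one_mem_graded 𝒜) (Ne.symm hn)]
      exact zero_mem _
  let T : Subalgebra k A :=
    { carrier := {h | ∀ x ∈ Q, h * x ∈ Q}
      mul_mem' := fun {a b} ha hb x hx => by rw [mul_assoc]; exact ha _ (hb _ hx)
      add_mem' := fun {a b} ha hb x hx => by rw [add_mul]; exact hQadd _ (ha _ hx) _ (hb _ hx)
      algebraMap_mem' := fun c => hQh 0 _ (SetLike.algebraMap_mem_graded 𝒜 c) fun n x hx => by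
        rw [zero_add]; exact hE0 n _ (SetLike.algebraMap_mem_graded 𝒜 c) x hx }
  have hT : T = ⊤ := by
    rw [← top_le_iff, ← hs, Algebra.adjoin_le_iff]
    intro y hy x hx
    rw [← DirectSum.sum_support_decompose 𝒜 y, Finset.sum_mul]
    have : ∀ u : Finset ℕ, ∑ i ∈ u, (DirectSum.decompose 𝒜 y i : A) * x ∈ Q := by
      intro u
      induction u using Finset.induction_on with
      | empty => simpa using hQ0
      | insert j u hj ih =>
        rw [Finset.sum_insert hj]
        refine hQadd _ (hQh j _ (SetLike.coe_mem _) (fun n z hz => ?_) _ hx) _ ih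
        rcases eq_or_ne j 0 with rfl | hj0
        · rw [zero_add]; exact hE0 n _ (SetLike.coe_mem _) _ hz
        · exact hE n j hj0 _ (hC y hy j) _ hz
    exact this _
  refine ⟨C + t₀, fun n f hf => ?_⟩
  have hfQ : f ∈ Q := by
    have : f ∈ T := hT ▸ Algebra.mem_top
    simpa using this 1 h1
  have hfE := hfQ n
  rw [DirectSum.decompose_of_mem_same 𝒜 hf] at hfE
  clear hf hfQ
  induction hfE using AddSubmonoid.closure_induction with
  | mem x hx =>
    obtain ⟨a, ha, y, hy, rfl⟩ := hx
    refine ((ht₀ a ha).mul _ e hy).mono _ e ?_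
    nlinarith [Nat.zero_le (t₀ * n), Nat.zero_le C]
  | zero => exact ActsWithDegree.zero _ e _
  | add x y _ _ hx hy => exact hx.add _ e hy
/-- A family in `A` all of whose nontrivial `k`-linear combinations have the same nonzero value. -/
def LeafIndependent (k : Type*) {A Γ₀ : Type*} [Field k] [CommRing A] [Algebra k A]
    [LinearOrderedCommGroupWithZero Γ₀] (w : Valuation A Γ₀) {D : ℕ} (f : Fin D → A) : Prop :=
  ∃ γ : Γ₀, γ ≠ 0 ∧ ∀ c : Fin D → k, c ≠ 0 → w (∑ i, c i • f i) = γ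

/-- The vector `ν f` of integers is an additive coordinate for the valuation `w` of a domain. -/
structure IsValueVector (k : Type*) {A Γ₀ : Type*} [Field k] [CommRing A] [Algebra k A]
    [LinearOrderedCommGroupWithZero Γ₀] (w : Valuation A Γ₀) {N : ℕ} (ν : A → Fin N → ℤ) : Prop where
  zero_iff : ∀ f, w f = 0 ↔ f = 0
  algebraMap_le : ∀ c : k, w (algebraMap k A c) ≤ 1
  mul : ∀ f g, f ≠ 0 → g ≠ 0 → ν (f * g) = ν f + ν g
  eq_iff : ∀ f g, f ≠ 0 → g ≠ 0 → (ν f = ν g ↔ w f = w g)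

theorem MonomialOrder.degree_apply_le_totalDegree {k : Type*} [Field k] {N : ℕ}
    (o : MonomialOrder (Fin N)) (a : MvPolynomial (Fin N) k) (ha : a ≠ 0) (i : Fin N) :
    o.degree a i ≤ a.totalDegree := by
  have h : o.degree a ∈ a.support := o.degree_mem_support_iff a |>.2 ha
  refine le_trans ?_ (MvPolynomial.le_totalDegree h)
  by_cases hi : i ∈ (o.degree a).support
  · exact Finset.single_le_sum (f := fun i => o.degree a i) (fun _ _ => Nat.zero_le _) hi
  · rw [Finsupp.notMem_support_iff.1 hi]; exact Nat.zero_le _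

open MonomialOrder in
theorem not_leafIndependent_of_span {k A Γ₀ : Type*} [Field k] [CommRing A] [IsDomain A] [Algebra k A]
    [LinearOrderedCommGroupWithZero Γ₀] {N r : ℕ}
    (g : MvPolynomial (Fin N) k →ₐ[k] A) (hg : Function.Injective g) (e : Fin r → A)
    (hspan : ∀ f, ∃ c : Fin r → MvPolynomial (Fin N) k, f = ∑ i, g (c i) * e i)
    (w : Valuation A Γ₀)
    (hwg : ∀ a b : MvPolynomial (Fin N) k, a ≠ 0 → b ≠ 0 →
      (w (g a) < w (g b) ↔ (lex (σ := Fin N)).degree a ≺[lex] (lex (σ := Fin N)).degree b))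
    (hw0 : ∀ f, w f = 0 ↔ f = 0)
    (f : Fin (r + 1) → A) : ¬ LeafIndependent k w f := by
  classical
  rintro ⟨γ, hγ, hf⟩
  let o : MonomialOrder (Fin N) := lex
  have hwf : ∀ i, w (f i) = γ := fun i => by
    have := hf (Pi.single i 1) (by simp)
    rwa [Finset.sum_eq_single i (by intro j _ hj; simp [hj]) (by simp), Pi.single_eq_same,
      one_smul] at this
  let : Module (MvPolynomial (Fin N) k) A := Module.compHom A (g : MvPolynomial (Fin N) k →+* A)
  have hsm : ∀ (a : MvPolynomial (Fin N) k) (x : A), a • x = g a * x := fun a x => rfl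
  have hdep : ¬ LinearIndependent (MvPolynomial (Fin N) k) f := by
    intro hli
    have hle := linearIndependent_le_span_finset f hli (Finset.univ.image e) (by
      rw [eq_top_iff]
      intro x _
      obtain ⟨c, rfl⟩ := hspan x
      refine Submodule.sum_mem _ fun i _ => ?_
      rw [← hsm]
      exact Submodule.smul_mem _ _ (Submodule.subset_span (by simp)))
    have h3 : (Finset.univ.image e).card ≤ r := Finset.card_image_le.trans (by simp)
    rw [Cardinal.mk_fin, Nat.cast_le] at hle
    omega
  rw [Fintype.not_linearIndependent_iff] at hdep
  obtain ⟨c, hc, i₀, hi₀⟩ := hdep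
  obtain ⟨i, hi, hmax⟩ := (Finset.univ.filter fun i => c i ≠ 0).exists_max_image
    (fun i => o.toSyn (o.degree (c i))) ⟨i₀, by simp [hi₀]⟩
  simp only [Finset.mem_filter, Finset.mem_univ, true_and] at hi hmax
  set δ := o.degree (c i) with hδ
  let l : Fin (r + 1) → k := fun j => (c j).coeff δ
  let X : MvPolynomial (Fin N) k := MvPolynomial.monomial δ 1
  have hX : X ≠ 0 := by simp [X]
  have hXdeg : o.degree X = δ := by
    simp [X, o.degree_monomial]
  have hl : l ≠ 0 := fun h => o.leadingCoeff_ne_zero_iff.2 hi (congrFun h i)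
  have hrest : ∀ j, w (g (c j - MvPolynomial.C (l j) * X)) < w (g X) := by
    intro j
    set b := c j - MvPolynomial.C (l j) * X with hb
    by_cases hb0 : b = 0
    · rw [hb0, map_zero, map_zero, zero_lt_iff, Ne, hw0, map_eq_zero_iff _ hg]; exact hX
    rw [hwg _ _ hb0 hX]
    change o.toSyn (o.degree b) < o.toSyn (o.degree X)
    rw [hXdeg]
    have hle : o.toSyn (o.degree b) ≤ o.toSyn δ := by
      refine o.degree_sub_le.trans (sup_le ?_ ?_)
      · by_cases hcj : c j = 0
        · simp [hcj]
        · exact hmax j hcj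
      · refine o.degree_mul_le.trans ?_
        rw [hXdeg, o.degree_C, zero_add]
    refine lt_of_le_of_ne hle fun heq => ?_
    have heq' := o.toSyn.injective heq
    have : b.coeff δ = 0 := by simp [hb, l, X]
    rw [← heq'] at this
    exact o.leadingCoeff_ne_zero_iff.2 hb0 this
  have hsum : g X * ∑ j, l j • f j = - ∑ j, g (c j - MvPolynomial.C (l j) * X) * f j := by
    have h0 : ∑ j, g (c j) * f j = 0 := hc
    have hCl : ∀ c : k, g (MvPolynomial.C c) = algebraMap k A c := g.commutes
    simp only [map_sub, map_mul, sub_mul, Finset.sum_sub_distrib, h0, zero_sub, neg_neg,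
      Finset.mul_sum, Algebra.smul_def, hCl]
    exact Finset.sum_congr rfl fun j _ => by ring
  have h1 := congrArg w hsum
  rw [map_mul, hf l hl, w.map_neg] at h1
  have hgX : w (g X) ≠ 0 := by rw [Ne, hw0, map_eq_zero_iff _ hg]; exact hX
  refine absurd h1 (ne_of_gt (w.map_sum_lt (mul_ne_zero hgX hγ) fun j _ => ?_))
  rw [map_mul, hwf]
  exact mul_lt_mul_of_pos_right (hrest j) (zero_lt_iff.2 hγ)

open MonomialOrder in
theorem exists_isValueVector.{u, v} {k : Type u} {A : Type v} [Field k] [CommRing A] [IsDomain A] [Algebra k A]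
    (𝒜 : ℕ → Submodule k A) [GradedAlgebra 𝒜] (hFT : Algebra.FiniteType k A)
    (hA0 : FiniteDimensional k (𝒜 0)) :
    ∃ (Γ₀ : Type v) (_ : LinearOrderedCommGroupWithZero Γ₀) (w : Valuation A Γ₀) (N : ℕ)
      (ν : A → Fin N → ℤ) (C r : ℕ), IsValueVector k w ν ∧
      (∀ n, ∀ f ∈ 𝒜 n, f ≠ 0 → ∀ i, |ν f i| ≤ C * (n + 1)) ∧
      ∀ f : Fin (r + 1) → A, ¬ LeafIndependent k w f := by
  classical
  obtain ⟨N, g, hg, hfin⟩ := exists_finite_inj_algHom_of_fg k A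
  obtain ⟨Γ₀, hΓ, w, hw0, hw⟩ := exists_valuation_of_mvPolynomial (g : MvPolynomial (Fin N) k →+* A) hg
  obtain ⟨r, e, hspan⟩ : ∃ (r : ℕ) (e : Fin r → A),
      ∀ f, ∃ c : Fin r → MvPolynomial (Fin N) k, f = ∑ i, g (c i) * e i := by
    let := (g : MvPolynomial (Fin N) k →+* A).toAlgebra
    have : Module.Finite (MvPolynomial (Fin N) k) A := hfin
    obtain ⟨r, e, he⟩ := Module.Finite.exists_fin (R := MvPolynomial (Fin N) k) (M := A)
    refine ⟨r, e, fun f => ?_⟩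
    have hf : f ∈ Submodule.span (MvPolynomial (Fin N) k) (Set.range e) := he ▸ Submodule.mem_top
    obtain ⟨c, hc⟩ := (Submodule.mem_span_range_iff_exists_fun _).1 hf
    exact ⟨c, hc.symm⟩
  obtain ⟨C, hC⟩ := exists_actsWithDegree_graded 𝒜 hFT hA0 g e hspan
  have he0 : e ≠ 0 := by
    rintro rfl
    obtain ⟨c, hc⟩ := hspan 1
    simp at hc
  let o : MonomialOrder (Fin N) := lex
  let x : Fin N → Γ₀ := fun i => w (g (MvPolynomial.X i))
  have hx : ∀ i, x i ≠ 0 := fun i => by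
    rw [Ne, hw0, map_eq_zero_iff _ hg]; exact MvPolynomial.X_ne_zero i
  let X : (Fin N → ℤ) → Γ₀ := fun z => ∏ i, x i ^ z i
  have hXadd : ∀ z z', X (z + z') = X z * X z' := fun z z' => by
    simp only [X, Pi.add_apply, zpow_add₀ (hx _), Finset.prod_mul_distrib]
  have hXsub : ∀ z z', X (z - z') = X z / X z' := fun z z' => by
    simp only [X, Pi.sub_apply, zpow_sub₀ (hx _), Finset.prod_div_distrib]
  have hXpow : ∀ (n : ℕ) z, X (n • z) = X z ^ n := fun n z => by
    simp only [X, ← Finset.prod_pow]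
    refine Finset.prod_congr rfl fun i _ => ?_
    rw [Pi.smul_apply, nsmul_eq_mul, mul_comm, zpow_mul, zpow_natCast]
  have hX0 : ∀ z, X z ≠ 0 := fun z => Finset.prod_ne_zero_iff.2 fun i _ => zpow_ne_zero _ (hx i)
  have hXmon : ∀ u : Fin N →₀ ℕ, X (fun i => (u i : ℤ)) = w (g (MvPolynomial.monomial u 1)) := by
    intro u
    rw [MvPolynomial.monomial_eq, MvPolynomial.C_1, one_mul, Finsupp.prod_fintype _ _ (by simp)]
    simp only [X, x, map_prod, map_pow, zpow_natCast]
  have hXpoly : ∀ a : MvPolynomial (Fin N) k, a ≠ 0 → w (g a) = X (fun i => (o.degree a i : ℤ)) := by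
    intro a ha
    rw [hXmon]
    refine (hw _ _ ha (by simp)).1.2 ?_
    change o.degree a = o.degree _
    simp [o.degree_monomial]
  have hXinj : Function.Injective X := by
    intro z z' h
    let u : Fin N →₀ ℕ := Finsupp.equivFunOnFinite.symm fun i => (z i - z' i).toNat
    let u' : Fin N →₀ ℕ := Finsupp.equivFunOnFinite.symm fun i => (z' i - z i).toNat
    have huu : z + (fun i => (u' i : ℤ)) = z' + fun i => (u i : ℤ) := by
      ext i; simp [u, u']; omega
    have h1 := congrArg X huu
    rw [hXadd, hXadd, h, hXmon, hXmon] at h1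
    have h2 := mul_left_cancel₀ (hX0 z') h1
    have h3 : o.degree (MvPolynomial.monomial u' (1 : k)) = o.degree (MvPolynomial.monomial u (1 : k)) :=
      (hw _ _ (by simp) (by simp)).1.1 h2
    simp only [o.degree_monomial, one_ne_zero, if_false] at h3
    ext i
    have h4 := DFunLike.congr_fun h3 i
    simp [u, u'] at h4
    omega
  let M := Nat.factorial r
  have hM : M ≠ 0 := Nat.factorial_ne_zero r
  have hrel : ∀ f t, f ≠ 0 → ActsWithDegree MvPolynomial.totalDegree
      (g : MvPolynomial (Fin N) k →+* A) e t f →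
      ∃ z : Fin N → ℤ, w f ^ M = X z ∧ ∀ i, |z i| ≤ M * (r * t) := by
    intro f t hf hact
    obtain ⟨q, hqm, hqd, hqt, hq0⟩ := hact.exists_monic _ e he0
    rw [Polynomial.eval₂_eq_sum_range] at hq0
    have hpne : ∀ j, q.coeff j ≠ 0 → g (q.coeff j) * f ^ j ≠ 0 := fun j h =>
      mul_ne_zero (by rwa [Ne, map_eq_zero_iff _ hg]) (pow_ne_zero _ hf)
    obtain ⟨i, hi, j, hj, hij, hi0, hj0, heq⟩ := w.exists_ne_map_eq_of_sum_eq_zero hw0 _ _ hq0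
      ⟨q.natDegree, by simp, hpne _ (by rw [hqm.coeff_natDegree]; exact one_ne_zero)⟩
    wlog hlt : i < j generalizing i j
    · exact this j hj i hi hij.symm hj0 hi0 heq.symm (lt_of_le_of_ne (not_lt.1 hlt) hij.symm)
    have hqi : q.coeff i ≠ 0 := by rintro h; simp [h] at hi0
    have hqj : q.coeff j ≠ 0 := by rintro h; simp [h] at hj0
    rw [Finset.mem_range, hqd] at hi hj
    simp only [map_mul, map_pow, RingHom.coe_coe, hXpoly _ hqi, hXpoly _ hqj] at heq
    set a : Fin N → ℤ := fun l => (o.degree (q.coeff i) l : ℤ) with ha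
    set b : Fin N → ℤ := fun l => (o.degree (q.coeff j) l : ℤ) with hb
    have hwf : w f ≠ 0 := by rwa [Ne, hw0]
    have h1 : w f ^ (j - i) = X (a - b) := by
      rw [hXsub, eq_div_iff (hX0 _), pow_sub₀ _ hwf hlt.le]
      field_simp
      rw [mul_comm, ← heq, mul_comm]
    obtain ⟨d, hd⟩ : (j - i) ∣ M := Nat.dvd_factorial (by omega) (by omega)
    refine ⟨d • (a - b), ?_, fun l => ?_⟩
    · rw [hXpow, ← h1, ← pow_mul, ← hd]
    · have hdM : d ≤ M := by rw [hd]; exact Nat.le_mul_of_pos_left _ (by omega)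
      have ha1 : o.degree (q.coeff i) l ≤ r * t :=
        (o.degree_apply_le_totalDegree _ hqi l).trans (hqt i)
      have hb1 : o.degree (q.coeff j) l ≤ r * t :=
        (o.degree_apply_le_totalDegree _ hqj l).trans (hqt j)
      have hab : |a l - b l| ≤ (r * t : ℕ) := by
        rw [abs_le]; simp only [ha, hb]; constructor <;> omega
      rw [Pi.smul_apply, Pi.sub_apply, nsmul_eq_mul, abs_mul, Nat.abs_cast]
      push_cast at hab
      exact mul_le_mul (by exact_mod_cast hdM) hab (abs_nonneg _) (by positivity)
  have hrel' : ∀ f, f ≠ 0 → ∃ z : Fin N → ℤ, w f ^ M = X z := fun f hf => by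
    obtain ⟨t, ht⟩ := ActsWithDegree.exists_of_span (g : MvPolynomial (Fin N) k →+* A) e hspan f
    obtain ⟨z, hz, -⟩ := hrel f t hf ht
    exact ⟨z, hz⟩
  choose! ν hν using hrel'
  refine ⟨Γ₀, hΓ, w, N, ν, M * (r * C), r, ⟨hw0, fun c => ?_, fun f f' hf hf' => ?_,
    fun f f' hf hf' => ?_⟩, fun n f hf hf0 i => ?_, ?_⟩
  · by_cases hc : c = 0
    · simp [hc]
    · have h1 := (hw (MvPolynomial.C c) 1 (by simpa using hc) one_ne_zero).1.2 (by simp)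
      have h2 : g (MvPolynomial.C c) = algebraMap k A c := g.commutes c
      rw [← h2]
      simpa using h1.le
  · apply hXinj
    rw [hXadd, ← hν _ hf, ← hν _ hf', ← hν _ (mul_ne_zero hf hf'), map_mul, mul_pow]
  · rw [← hXinj.eq_iff, ← hν _ hf, ← hν _ hf']
    exact pow_left_inj₀ zero_le zero_le hM
  · obtain ⟨z, hz, hb⟩ := hrel f _ hf0 (hC n f hf)
    rw [hν f hf0] at hz
    rw [hXinj hz]
    refine (hb i).trans (le_of_eq ?_)
    push_cast; ring
  · exact not_leafIndependent_of_span g hg e hspan w (fun a b ha hb => (hw a b ha hb).2) hw0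

/-- The real vector underlying an integer vector. -/
def toRealVec {d : ℕ} (z : Fin d → ℤ) : Fin d → ℝ := fun i => z i

/-- A graded subsemigroup of `ℤ^d × ℕ` containing the origin, given by its graded pieces. -/
structure IsGradedSemigroup {d : ℕ} (S : ℕ → Set (Fin d → ℤ)) : Prop where
  zero_mem : 0 ∈ S 0
  add_mem : ∀ m n y z, y ∈ S m → z ∈ S n → y + z ∈ S (m + n)

/-- The elements of positive degree of a graded semigroup, as elements of `ℤ^d × ℤ`. -/
def posElements {d : ℕ} (S : ℕ → Set (Fin d → ℤ)) : Set ((Fin d → ℤ) × ℤ) :=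
  {h | ∃ n : ℕ, 0 < n ∧ h.2 = n ∧ h.1 ∈ S n}

/-- The slopes of the elements of positive degree of a graded semigroup. -/
def slopes {d : ℕ} (S : ℕ → Set (Fin d → ℤ)) : Set (Fin d → ℝ) :=
  {x | ∃ n : ℕ, 0 < n ∧ ∃ s ∈ S n, x = (n : ℝ)⁻¹ • toRealVec s}

namespace IsGradedSemigroup

variable {d : ℕ} {S : ℕ → Set (Fin d → ℤ)}

theorem nsmul_mem (hS : IsGradedSemigroup S) {m : ℕ} {y : Fin d → ℤ} (hy : y ∈ S m) (n : ℕ) :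
    n • y ∈ S (n * m) := by
  induction n with
  | zero => simpa using hS.zero_mem
  | succ n ih => rw [succ_nsmul, add_mul, one_mul]; exact hS.add_mem _ _ _ _ ih hy

theorem sum_nsmul_mem (hS : IsGradedSemigroup S) {I : Type*} (s : Finset I) (n : I → ℕ)
    (a : I → Fin d → ℤ) (ha : ∀ i, a i ∈ S (n i)) (c : I → ℕ) :
    ∑ i ∈ s, c i • a i ∈ S (∑ i ∈ s, c i * n i) := by
  classical
  induction s using Finset.induction_on with
  | empty => simpa using hS.zero_mem
  | insert i s hi ih =>
    rw [Finset.sum_insert hi, Finset.sum_insert hi]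
    exact hS.add_mem _ _ _ _ (hS.nsmul_mem (ha i) _) ih

theorem exists_weights_of_mem_interior {I : Type*} [Fintype I] {c : I → Fin d → ℝ}
    {x : Fin d → ℝ} (hx : x ∈ interior (convexHull ℝ (Set.range c))) :
    ∃ W ∈ 𝓝 x, ∃ δ : ℝ, 0 < δ ∧ ∀ y ∈ W, ∃ μ : I → ℝ, (∀ i, δ ≤ μ i) ∧ ∑ i, μ i = 1 ∧
      ∑ i, μ i • c i = y := by
  classical
  have hne : Nonempty I := by
    by_contra h
    rw [not_nonempty_iff] at h
    have := interior_subset hx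
    rw [Set.range_eq_empty, convexHull_empty] at this
    exact this
  set M : ℝ := (Fintype.card I : ℝ) with hM
  have hM0 : 0 < M := by rw [hM]; exact_mod_cast Fintype.card_pos
  set b : Fin d → ℝ := ∑ i, (1 / M) • c i with hb
  have hcont : Continuous fun t : ℝ => x + t • (x - b) := by fun_prop
  have hev : ∀ᶠ t in 𝓝 (0 : ℝ), x + t • (x - b) ∈ interior (convexHull ℝ (Set.range c)) := by
    refine hcont.continuousAt.eventually_mem (isOpen_interior.mem_nhds ?_)
    simpa using hx
  obtain ⟨t, ht, ht0⟩ := ((hev.filter_mono nhdsWithin_le_nhds).and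
    (self_mem_nhdsWithin : Set.Ioi (0 : ℝ) ∈ 𝓝[>] 0)).exists
  have ht0 : 0 < t := ht0
  have hcont2 : Continuous fun y : Fin d → ℝ => y + t • (y - b) := by fun_prop
  refine ⟨(fun y : Fin d → ℝ => y + t • (y - b)) ⁻¹' interior (convexHull ℝ (Set.range c)),
    hcont2.continuousAt (isOpen_interior.mem_nhds ht), t / (M * (1 + t)), by positivity, ?_⟩
  intro y hy
  have hy := interior_subset hy
  rw [convexHull_range_eq_exists_affineCombination] at hy
  obtain ⟨u, w, hw0, hw1, hw⟩ := hy
  rw [u.affineCombination_eq_linear_combination _ _ hw1] at hw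
  let w' : I → ℝ := fun i => if i ∈ u then w i else 0
  have hw'0 : ∀ i, 0 ≤ w' i := fun i => by
    dsimp [w']; split_ifs with h
    · exact hw0 i h
    · exact le_rfl
  have hw'1 : ∑ i, w' i = 1 := by simp [w', hw1]
  have hw'2 : ∑ i, w' i • c i = y + t • (y - b) := by
    simp only at hw
    rw [← hw]; simp [w', ite_smul]
  refine ⟨fun i => (w' i + t / M) / (1 + t), fun i => ?_, ?_, ?_⟩
  · rw [div_mul_eq_div_div]
    exact div_le_div_of_nonneg_right (by linarith [hw'0 i]) (by positivity)
  · rw [← Finset.sum_div, Finset.sum_add_distrib, hw'1]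
    simp only [Finset.sum_const, Finset.card_univ, nsmul_eq_mul]
    rw [← hM]; field_simp
  · have h1 : ∀ i, ((w' i + t / M) / (1 + t)) • c i
        = (1 + t)⁻¹ • (w' i • c i + t • ((1 / M) • c i)) := fun i => by
      rw [smul_smul, ← add_smul, smul_smul]; congr 1; ring
    simp_rw [h1]
    rw [← Finset.smul_sum, Finset.sum_add_distrib, ← Finset.smul_sum, hw'2, ← hb]
    have : y + t • (y - b) + t • b = (1 + t) • y := by
      rw [smul_sub, add_smul, one_smul]; abel
    rw [this, smul_smul, inv_mul_cancel₀ (by positivity), one_smul]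

theorem exists_nhds_of_finite (hS : IsGradedSemigroup S) {I : Type*} [Fintype I] (a : I → Fin d → ℤ)
    (n : I → ℕ) (hn : ∀ i, 0 < n i) (ha : ∀ i, a i ∈ S (n i))
    (hgen : Submodule.span ℤ (Set.range fun i => (a i, (n i : ℤ))) = ⊤) {x : Fin d → ℝ}
    (hx : x ∈ interior (convexHull ℝ (Set.range fun i => (n i : ℝ)⁻¹ • toRealVec (a i)))) :
    ∃ W ∈ 𝓝 x, ∃ p₀ : ℕ, ∀ p ≥ p₀, ∀ y : Fin d → ℤ, (p : ℝ)⁻¹ • toRealVec y ∈ W → y ∈ S p := by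
  classical
  obtain ⟨W, hW, δ, hδ, hμ⟩ := exists_weights_of_mem_interior hx
  have hrep : ∀ h : (Fin d → ℤ) × ℤ, ∃ k : I → ℤ, ∑ i, k i • (a i, (n i : ℤ)) = h := fun h =>
    (Submodule.mem_span_range_iff_exists_fun ℤ).1 (hgen ▸ Submodule.mem_top)
  choose k hk using hrep
  set B : ℤ := ∑ i, (∑ j, |a i j| + n i) with hB
  let F : Set ((Fin d → ℤ) × ℤ) := Set.Icc (fun _ => -B, -B) (fun _ => B, B)
  have hF : F.Finite := Set.finite_Icc _ _
  obtain ⟨M, hM⟩ : ∃ M : ℤ, ∀ h ∈ F, ∀ i, -M ≤ k h i := by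
    obtain ⟨M, hM⟩ := (hF.toFinset.image fun h => ∑ i, |k h i|).bddAbove
    refine ⟨M, fun h hh i => ?_⟩
    have h1 : ∑ i, |k h i| ≤ M := hM (by
      simp only [Finset.coe_image]; exact ⟨h, by simpa using hh, rfl⟩)
    have h2 : |k h i| ≤ ∑ i, |k h i| :=
      Finset.single_le_sum (f := fun i => |k h i|) (fun _ _ => abs_nonneg _) (Finset.mem_univ i)
    have := neg_abs_le (k h i)
    omega
  obtain ⟨p₀, hp₀⟩ : ∃ p₀ : ℕ, ∀ p ≥ p₀, 0 < p ∧ ∀ i, (M : ℝ) + 1 ≤ p * δ / n i := by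
    have h1 : ∀ i, ∀ᶠ p : ℕ in atTop, (M : ℝ) + 1 ≤ p * δ / n i := fun i => by
      have : Tendsto (fun p : ℕ => (p : ℝ) * (δ / n i)) atTop atTop :=
        tendsto_natCast_atTop_atTop.atTop_mul_const (div_pos hδ (by exact_mod_cast hn i))
      filter_upwards [this.eventually_ge_atTop ((M : ℝ) + 1)] with p hp
      rwa [mul_div_assoc]
    obtain ⟨p₀, h⟩ := eventually_atTop.1 ((eventually_gt_atTop 0).and (eventually_all.2 h1))
    exact ⟨p₀, h⟩
  refine ⟨W, hW, p₀, fun p hp y hy => ?_⟩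
  obtain ⟨hp0, hpδ⟩ := hp₀ p hp
  obtain ⟨μ, hμδ, hμ1, hμy⟩ := hμ _ hy
  have hpR : (p : ℝ) ≠ 0 := by positivity
  have hnR : ∀ i, (n i : ℝ) ≠ 0 := fun i => by exact_mod_cast (hn i).ne'
  let lam : I → ℝ := fun i => p * μ i / n i
  have hlam2 : ∑ i, lam i * n i = p := by
    have : ∀ i, lam i * n i = p * μ i := fun i => by
      have := hnR i
      dsimp [lam]; field_simp
    simp_rw [this, ← Finset.mul_sum, hμ1, mul_one]
  have hlam1 : ∀ j, ∑ i, lam i * a i j = y j := fun j => by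
    have h := congrFun hμy j
    simp only [Finset.sum_apply, Pi.smul_apply, smul_eq_mul, toRealVec] at h
    have h2 : (y j : ℝ) = p * ((p : ℝ)⁻¹ * y j) := by field_simp
    rw [h2, ← h, Finset.mul_sum]
    refine Finset.sum_congr rfl fun i _ => ?_
    dsimp [lam]; ring
  let q : I → ℤ := fun i => ⌊lam i⌋
  let h : (Fin d → ℤ) × ℤ := (y, (p : ℤ)) - ∑ i, q i • (a i, (n i : ℤ))
  have hfr : ∀ (z : I → ℤ) (c : ℤ), ∑ i, lam i * z i = c → |c - ∑ i, q i * z i| ≤ ∑ i, |z i| := by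
    intro z c hz
    have : (c : ℝ) - ∑ i, (q i : ℝ) * z i = ∑ i, Int.fract (lam i) * z i := by
      rw [← hz, ← Finset.sum_sub_distrib]
      refine Finset.sum_congr rfl fun i _ => ?_
      rw [← sub_mul]; rfl
    have h2 : |(c : ℝ) - ∑ i, (q i : ℝ) * z i| ≤ ∑ i, |(z i : ℝ)| := by
      rw [this]
      refine (Finset.abs_sum_le_sum_abs _ _).trans (Finset.sum_le_sum fun i _ => ?_)
      rw [abs_mul, abs_of_nonneg (Int.fract_nonneg _)]
      exact mul_le_of_le_one_left (abs_nonneg _) (Int.fract_lt_one _).le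
    exact_mod_cast h2
  have hh1 : ∀ j, h.1 j = y j - ∑ i, q i * a i j := fun j => by
    simp [h, Prod.fst_sum]
  have hh2 : h.2 = p - ∑ i, q i * n i := by
    simp [h, Prod.snd_sum]
  have hhF : h ∈ F := by
    have e1 : ∀ j, |h.1 j| ≤ B := fun j => by
      rw [hh1]
      refine (hfr (fun i => a i j) _ (hlam1 j)).trans (Finset.sum_le_sum fun i _ => ?_)
      have := Finset.single_le_sum (f := fun j => |a i j|) (fun _ _ => abs_nonneg _)
        (Finset.mem_univ j)
      have h0 : (0 : ℤ) ≤ n i := by positivity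
      linarith
    have e2 : |h.2| ≤ B := by
      rw [hh2]
      refine (hfr (fun i => n i) _ (by exact_mod_cast hlam2)).trans
        (Finset.sum_le_sum fun i _ => ?_)
      have : 0 ≤ ∑ j, |a i j| := Finset.sum_nonneg fun _ _ => abs_nonneg _
      have h3 : |(n i : ℤ)| = n i := abs_of_nonneg (by positivity)
      rw [h3]
      omega
    exact ⟨⟨fun j => (abs_le.1 (e1 j)).1, (abs_le.1 e2).1⟩,
      fun j => (abs_le.1 (e1 j)).2, (abs_le.1 e2).2⟩
  have hpos : ∀ i, 0 ≤ q i + k h i := fun i => by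
    have h1 := hM h hhF i
    have h2 : (M : ℝ) ≤ lam i - 1 := by
      have h3 : (p : ℝ) * δ / n i ≤ lam i := by
        dsimp [lam]; gcongr; exact hμδ i
      linarith [hpδ i]
    have h3 : M ≤ q i := by
      rw [Int.le_floor]; linarith
    omega
  have hsum : ∑ i, (q i + k h i) • (a i, (n i : ℤ)) = (y, (p : ℤ)) := by
    simp_rw [add_smul]
    rw [Finset.sum_add_distrib, hk h]
    simp [h]
  have hmem := hS.sum_nsmul_mem Finset.univ n a ha fun i => (q i + k h i).toNat
  have hto : ∀ i, (((q i + k h i).toNat : ℕ) : ℤ) = q i + k h i := fun i => Int.toNat_of_nonneg (hpos i)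
  have e1 : ∑ i, (q i + k h i).toNat • a i = y := by
    have := congrArg Prod.fst hsum
    simp only [Prod.fst_sum, Prod.smul_fst] at this
    rw [← this]
    refine Finset.sum_congr rfl fun i _ => ?_
    rw [← natCast_zsmul, hto]
  have e2 : ∑ i, (q i + k h i).toNat * n i = p := by
    have := congrArg Prod.snd hsum
    simp only [Prod.snd_sum, Prod.smul_snd] at this
    zify
    rw [← this]
    refine Finset.sum_congr rfl fun i _ => ?_
    rw [hto, smul_eq_mul]
  rw [e1, e2] at hmem
  exact hmem

theorem exists_nhds (hS : IsGradedSemigroup S) (hgen : Submodule.span ℤ (posElements S) = ⊤)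
    {x : Fin d → ℝ} (hx : x ∈ interior (convexHull ℝ (slopes S))) :
    ∃ W ∈ 𝓝 x, ∃ p₀ : ℕ, ∀ p ≥ p₀, ∀ y : Fin d → ℤ, (p : ℝ)⁻¹ • toRealVec y ∈ W → y ∈ S p := by
  classical
  obtain ⟨b, hb, hbs⟩ := exists_mem_interior_convexHull_affineBasis (mem_interior_iff_mem_nhds.1 hx)
  have hfin : ∀ i, ∃ t : Finset (Fin d → ℝ), ↑t ⊆ slopes S ∧ b i ∈ convexHull ℝ (t : Set (Fin d → ℝ)) :=
    fun i => by
      have := hbs (subset_convexHull ℝ _ (Set.mem_range_self i))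
      rw [convexHull_eq_union_convexHull_finite_subsets] at this
      simpa using this
  choose t ht hbt using hfin
  obtain ⟨T, hT, hTspan⟩ := (Submodule.fg_span_iff_fg_span_finset_subset (R := ℤ) (posElements S)).1
    (IsNoetherian.noetherian _)
  let slope : (Fin d → ℤ) × ℤ → Fin d → ℝ := fun h => (h.2 : ℝ)⁻¹ • toRealVec h.1
  have hlift : ∀ i, ∀ z : t i, ∃ h ∈ posElements S, slope h = z := fun i z => by
    obtain ⟨n, hn, s, hs, hz⟩ := ht i z.2
    exact ⟨(s, n), ⟨n, hn, rfl, hs⟩, by simp [slope, hz]⟩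
  choose g hg hgs using hlift
  let I := T ⊕ (Σ i, t i)
  let e : I → (Fin d → ℤ) × ℤ := Sum.elim (fun h => h) (fun z => g z.1 z.2)
  have he : ∀ i, e i ∈ posElements S := by
    rintro (h | z)
    · exact hT h.2
    · exact hg _ _
  choose n hn hen heS using he
  have hpair : (fun i => ((e i).1, (n i : ℤ))) = e := by
    funext i; rw [← hen i]
  refine hS.exists_nhds_of_finite (fun i => (e i).1) n hn heS ?_ ?_
  · rw [hpair, eq_top_iff, ← hgen, hTspan]
    refine Submodule.span_mono ?_
    intro h hh
    exact ⟨Sum.inl ⟨h, hh⟩, rfl⟩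
  · have hsl : (fun i => (n i : ℝ)⁻¹ • toRealVec (e i).1) = fun i => slope (e i) := by
      funext i; simp [slope, hen i]
    rw [hsl]
    refine interior_mono (convexHull_min ?_ (convex_convexHull ℝ _)) hb
    rintro _ ⟨i, rfl⟩
    refine convexHull_mono ?_ (hbt i)
    intro z hz
    exact ⟨Sum.inr ⟨i, ⟨z, hz⟩⟩, hgs i ⟨z, hz⟩⟩


theorem eventually_mem_of_isCompact (hS : IsGradedSemigroup S)
    (hgen : Submodule.span ℤ (posElements S) = ⊤) {K : Set (Fin d → ℝ)} (hK : IsCompact K)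
    (hKS : K ⊆ interior (convexHull ℝ (slopes S))) :
    ∃ p₀ : ℕ, ∀ p ≥ p₀, ∀ y : Fin d → ℤ, (p : ℝ)⁻¹ • toRealVec y ∈ K → y ∈ S p := by
  refine hK.induction_on (p := fun K => ∃ p₀ : ℕ, ∀ p ≥ p₀, ∀ y : Fin d → ℤ,
    (p : ℝ)⁻¹ • toRealVec y ∈ K → y ∈ S p) ⟨0, by simp⟩ ?_ ?_ ?_
  · rintro s t hst ⟨p₀, h⟩
    exact ⟨p₀, fun p hp y hy => h p hp y (hst hy)⟩
  · rintro s t ⟨p₀, h⟩ ⟨p₁, h'⟩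
    refine ⟨max p₀ p₁, fun p hp y hy => hy.elim (h p ?_ y) (h' p ?_ y)⟩
    · exact (le_max_left _ _).trans hp
    · exact (le_max_right _ _).trans hp
  · intro x hx
    obtain ⟨W, hW, p₀, h⟩ := hS.exists_nhds hgen (hKS hx)
    exact ⟨W, mem_nhdsWithin_of_mem_nhds hW, p₀, h⟩

end IsGradedSemigroup
/-- The volume of the convex body spanned by the slopes of a graded semigroup. -/
noncomputable def slopeVolume {d : ℕ} (S : ℕ → Set (Fin d → ℤ)) : ℝ :=
  MeasureTheory.volume.real (closure (convexHull ℝ (slopes S)))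

theorem toRealVec_injective {d : ℕ} : Function.Injective (toRealVec : (Fin d → ℤ) → Fin d → ℝ) := by
  intro y z h
  funext i
  have := congrFun h i
  simpa [toRealVec] using this

theorem finite_latticePoints {d n : ℕ} (hn : 0 < n) {K : Set (Fin d → ℝ)}
    (hK : Bornology.IsBounded K) : {y : Fin d → ℤ | (n : ℝ)⁻¹ • toRealVec y ∈ K}.Finite := by
  obtain ⟨R, hR⟩ := hK.exists_norm_le
  refine (Set.finite_Icc (fun _ => -⌈n * R⌉ : Fin d → ℤ) (fun _ => ⌈n * R⌉)).subset ?_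
  intro y hy
  have h1 := hR _ hy
  have hn' : (0 : ℝ) < n := by exact_mod_cast hn
  have h2 : ∀ i, |(y i : ℝ)| ≤ n * R := fun i => by
    have h3 := (norm_le_pi_norm _ i).trans h1
    rw [Pi.smul_apply, norm_smul, norm_inv, Real.norm_natCast, Real.norm_eq_abs,
      inv_mul_le_iff₀ hn'] at h3
    exact h3
  have h4 : ∀ i, |y i| ≤ ⌈n * R⌉ := fun i => by
    have := (h2 i).trans (Int.le_ceil _)
    exact_mod_cast this
  exact ⟨fun i => (abs_le.1 (h4 i)).1, fun i => (abs_le.1 (h4 i)).2⟩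

theorem tendsto_ncard_latticePoints {d : ℕ} {K : Set (Fin d → ℝ)} (hK : Bornology.IsBounded K)
    (hm : MeasurableSet K) (hc : Convex ℝ K) :
    Tendsto (fun n : ℕ => ({y : Fin d → ℤ | (n : ℝ)⁻¹ • toRealVec y ∈ K}.ncard : ℝ) / (n : ℝ) ^ d)
      atTop (𝓝 (MeasureTheory.volume.real K)) := by
  have h := tendsto_card_div_pow_atTop_volume K hK hm (hc.addHaar_frontier _)
  rw [Fintype.card_fin] at h
  refine h.congr' ?_
  filter_upwards [eventually_gt_atTop 0] with n hn
  have hn' : (n : ℝ) ≠ 0 := by positivity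
  congr 2
  rw [Nat.card_coe_set_eq]
  have hinj : Function.Injective fun y : Fin d → ℤ => (n : ℝ)⁻¹ • toRealVec y := fun y z hyz =>
    toRealVec_injective (smul_right_injective _ (inv_ne_zero hn') hyz)
  rw [← Set.ncard_image_of_injective _ hinj]
  congr 1
  ext x
  simp only [Set.mem_inter_iff, Set.mem_image, Set.mem_smul_set, SetLike.mem_coe]
  constructor
  · rintro ⟨hx, z, hz, rfl⟩
    rw [Module.Basis.mem_span_iff_repr_mem] at hz
    choose y hy using hz
    have : toRealVec y = z := by
      funext i
      have := hy i
      simpa [toRealVec] using this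
    exact ⟨y, by simpa [this] using hx, by rw [this]⟩
  · rintro ⟨y, hy, rfl⟩
    refine ⟨hy, toRealVec y, ?_, rfl⟩
    rw [Module.Basis.mem_span_iff_repr_mem]
    intro i
    exact ⟨y i, by simp [toRealVec]⟩

namespace IsGradedSemigroup

variable {d : ℕ} {S : ℕ → Set (Fin d → ℤ)}

theorem exists_isCompact_lt (hb : Bornology.IsBounded (slopes S)) {v : ℝ} (hv : v < slopeVolume S) :
    ∃ K : Set (Fin d → ℝ), IsCompact K ∧ Convex ℝ K ∧ K ⊆ interior (convexHull ℝ (slopes S)) ∧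
      v < MeasureTheory.volume.real K := by
  rcases lt_or_ge v 0 with h0 | h0
  · exact ⟨∅, isCompact_empty, convex_empty, Set.empty_subset _, by simpa using h0⟩
  have hbb : Bornology.IsBounded (convexHull ℝ (slopes S)) := isBounded_convexHull.2 hb
  have hconv : Convex ℝ (convexHull ℝ (slopes S)) := convex_convexHull ℝ _
  have hvol_int : MeasureTheory.volume (interior (convexHull ℝ (slopes S)))
      = MeasureTheory.volume (closure (convexHull ℝ (slopes S))) :=
    measure_interior_of_null_frontier (hconv.addHaar_frontier _) |>.trans
      (measure_closure_of_null_frontier (hconv.addHaar_frontier _)).symm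
  have hlt : ENNReal.ofReal v < MeasureTheory.volume (interior (convexHull ℝ (slopes S))) := by
    rw [hvol_int]
    exact (ENNReal.ofReal_lt_iff_lt_toReal h0 hbb.closure.measure_lt_top.ne).2 hv
  obtain ⟨K, hK, hKc, hKv⟩ := isOpen_interior.exists_lt_isCompact hlt
  obtain ⟨u, hu, huU, huK⟩ : ∃ u : Set (Fin d → ℝ), u.Finite ∧
      u ⊆ interior (convexHull ℝ (slopes S)) ∧ K ⊆ convexHull ℝ u := by
    refine hKc.induction_on (p := fun K => ∃ u : Set (Fin d → ℝ), u.Finite ∧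
      u ⊆ interior (convexHull ℝ (slopes S)) ∧ K ⊆ convexHull ℝ u) ⟨∅, by simp⟩ ?_ ?_ ?_
    · rintro s t hst ⟨u, hu, hu', h⟩
      exact ⟨u, hu, hu', hst.trans h⟩
    · rintro s t ⟨u, hu, hu', h⟩ ⟨u₁, hu₁, hu₁', h₁⟩
      exact ⟨u ∪ u₁, hu.union hu₁, Set.union_subset hu' hu₁', Set.union_subset
        (h.trans (convexHull_mono Set.subset_union_left))
        (h₁.trans (convexHull_mono Set.subset_union_right))⟩
    · intro x hx
      obtain ⟨b, hb₁, hb₂⟩ := exists_mem_interior_convexHull_affineBasis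
        (isOpen_interior.mem_nhds (hK hx))
      exact ⟨_, mem_nhdsWithin_of_mem_nhds (mem_interior_iff_mem_nhds.1 hb₁), Set.range b,
        Set.finite_range _, (subset_convexHull ℝ _).trans hb₂, subset_rfl⟩
  have hcc : IsCompact (convexHull ℝ u) := hu.isCompact_convexHull ℝ
  refine ⟨convexHull ℝ u, hcc, convex_convexHull ℝ _, convexHull_min huU hconv.interior, ?_⟩
  exact (ENNReal.ofReal_lt_iff_lt_toReal h0 hcc.measure_lt_top.ne).1
    (hKv.trans_le (MeasureTheory.measure_mono huK))

theorem subset_latticePoints {n : ℕ} (hn : 0 < n) :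
    S n ⊆ {y | (n : ℝ)⁻¹ • toRealVec y ∈ closure (convexHull ℝ (slopes S))} := fun y hy =>
  subset_closure (subset_convexHull ℝ _ ⟨n, hn, y, hy, rfl⟩)

theorem finite (hb : Bornology.IsBounded (slopes S)) {n : ℕ} (hn : 0 < n) : (S n).Finite :=
  (finite_latticePoints hn (isBounded_convexHull.2 hb).closure).subset (subset_latticePoints hn)

theorem tendsto_ncard (hS : IsGradedSemigroup S) (hgen : Submodule.span ℤ (posElements S) = ⊤)
    (hb : Bornology.IsBounded (slopes S)) :
    Tendsto (fun n : ℕ => ((S n).ncard : ℝ) / (n : ℝ) ^ d) atTop (𝓝 (slopeVolume S)) := by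
  have hbb : Bornology.IsBounded (closure (convexHull ℝ (slopes S))) :=
    (isBounded_convexHull.2 hb).closure
  rw [tendsto_order]
  constructor
  · intro v hv
    obtain ⟨K, hK, hKc, hKS, hKv⟩ := exists_isCompact_lt hb hv
    obtain ⟨p₀, hp⟩ := hS.eventually_mem_of_isCompact hgen hK hKS
    filter_upwards [(tendsto_ncard_latticePoints hK.isBounded hK.measurableSet hKc).eventually_const_lt
      hKv, eventually_ge_atTop p₀, eventually_gt_atTop 0] with n h1 h2 h3
    refine h1.trans_le ?_
    gcongr
    · exact finite hb h3
    · exact fun y hy => hp n h2 y hy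
  · intro v hv
    filter_upwards [(tendsto_ncard_latticePoints hbb isClosed_closure.measurableSet
      (convex_convexHull ℝ _).closure).eventually_lt_const hv, eventually_gt_atTop 0] with n h1 h3
    refine lt_of_le_of_lt ?_ h1
    gcongr
    · exact finite_latticePoints h3 hbb
    · exact subset_latticePoints h3

theorem eventually_mem_near (hS : IsGradedSemigroup S) (hgen : Submodule.span ℤ (posElements S) = ⊤)
    {K : Set (Fin d → ℝ)} (hK : IsCompact K) (hKS : K ⊆ interior (convexHull ℝ (slopes S))) :
    ∀ᶠ p : ℕ in atTop, ∀ x ∈ K, ∀ z : Fin d → ℤ, (∀ i, |(z i : ℝ) - p * x i| ≤ 1) → z ∈ S p := by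
  obtain ⟨δ, hδ, hδS⟩ := hK.exists_cthickening_subset_open isOpen_interior hKS
  obtain ⟨p₀, hp₀⟩ := hS.eventually_mem_of_isCompact hgen hK.cthickening hδS
  filter_upwards [eventually_ge_atTop p₀, eventually_gt_atTop 0,
    (tendsto_inv_atTop_nhds_zero_nat (𝕜 := ℝ)).eventually_le_const hδ] with p h1 h2 h3 x hx z hz
  refine hp₀ p h1 z ?_
  refine Metric.mem_cthickening_of_dist_le _ x δ K hx ?_
  have hp : (0 : ℝ) < p := by exact_mod_cast h2
  refine le_trans ((dist_pi_le_iff (by positivity)).2 fun i => ?_) h3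
  rw [Real.dist_eq]
  have : ((p : ℝ)⁻¹ • toRealVec z) i - x i = (p : ℝ)⁻¹ * (z i - p * x i) := by
    simp only [Pi.smul_apply, smul_eq_mul, toRealVec]; field_simp
  rw [this, abs_mul, abs_of_pos (inv_pos.2 hp)]
  exact mul_le_of_le_one_right (inv_pos.2 hp).le (hz i)

theorem eventually_span_eq_top (hS : IsGradedSemigroup S)
    (hgen : Submodule.span ℤ (posElements S) = ⊤)
    (hne : (interior (convexHull ℝ (slopes S))).Nonempty) :
    ∀ᶠ p : ℕ in atTop, (S p).Nonempty ∧ ∀ T : ℕ → Set (Fin d → ℤ), S p ⊆ T 1 →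
      Submodule.span ℤ (posElements T) = ⊤ := by
  obtain ⟨x, hx⟩ := hne
  filter_upwards [hS.eventually_mem_near hgen (isCompact_singleton (x := x))
    (Set.singleton_subset_iff.2 hx)] with p hp
  have hp := hp x rfl
  let y : Fin d → ℤ := fun i => ⌊p * x i⌋
  have hy1 : ∀ i, (y i : ℝ) ≤ p * x i := fun i => Int.floor_le _
  have hy2 : ∀ i, (p : ℝ) * x i < y i + 1 := fun i => Int.lt_floor_add_one _
  have hy : y ∈ S p := hp y fun i => by rw [abs_le]; constructor <;> linarith [hy1 i, hy2 i]
  refine ⟨⟨y, hy⟩, fun T hT => ?_⟩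
  have hye : ∀ j, y + Pi.single j 1 ∈ S p := fun j => hp _ fun i => by
    by_cases hij : i = j
    · subst hij
      simp only [Pi.add_apply, Pi.single_eq_same]
      push_cast
      rw [abs_le]; constructor <;> linarith [hy1 i, hy2 i]
    · simp only [Pi.add_apply, Pi.single_eq_of_ne hij, add_zero]
      rw [abs_le]; constructor <;> linarith [hy1 i, hy2 i]
  have hmem : ∀ s ∈ S p, (s, (1 : ℤ)) ∈ Submodule.span ℤ (posElements T) := fun s hs =>
    Submodule.subset_span ⟨1, one_pos, rfl, hT hs⟩
  have he : ∀ j, ((Pi.single j 1 : Fin d → ℤ), (0 : ℤ)) ∈ Submodule.span ℤ (posElements T) := fun j => by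
    have := Submodule.sub_mem _ (hmem _ (hye j)) (hmem _ hy)
    simpa using this
  have hz : ∀ z : Fin d → ℤ, (z, (0 : ℤ)) ∈ Submodule.span ℤ (posElements T) := fun z => by
    have h := Submodule.sum_mem (Submodule.span ℤ (posElements T)) (t := Finset.univ)
      fun j _ => Submodule.smul_mem _ (z j) (he j)
    have hz : (z, (0 : ℤ)) = ∑ j, z j • ((Pi.single j 1 : Fin d → ℤ), (0 : ℤ)) := by
      refine Prod.ext_iff.2 ⟨?_, by simp [Prod.snd_sum]⟩
      funext i
      simp [Prod.fst_sum, Finset.sum_apply, Pi.single_apply]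
    rwa [hz]
  rw [eq_top_iff]
  rintro ⟨z, n⟩ -
  have h1 := Submodule.add_mem _ (Submodule.smul_mem _ n (hmem _ hy)) (hz (z - n • y))
  simpa using h1

open Pointwise in
theorem eventually_le_slopeVolume (hS : IsGradedSemigroup S)
    (hgen : Submodule.span ℤ (posElements S) = ⊤) (hb : Bornology.IsBounded (slopes S)) {v : ℝ}
    (hv : v < slopeVolume S) :
    ∀ᶠ p : ℕ in atTop, ∀ T : ℕ → Set (Fin d → ℤ), Bornology.IsBounded (slopes T) → S p ⊆ T 1 →
      v * (p : ℝ) ^ d ≤ slopeVolume T := by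
  obtain ⟨K, hK, -, hKS, hKv⟩ := exists_isCompact_lt hb hv
  filter_upwards [hS.eventually_mem_near hgen hK hKS] with p hp T hTb hT
  have hsub : (p : ℝ) • K ⊆ convexHull ℝ (slopes T) := by
    rintro _ ⟨x, hx, rfl⟩
    let t : Fin d → Set ℝ := fun i => {(⌊p * x i⌋ : ℝ), (⌊p * x i⌋ : ℝ) + 1}
    have h1 : (p : ℝ) • x ∈ convexHull ℝ (Set.univ.pi t) := by
      refine mem_convexHull_pi fun i _ => ?_
      rw [convexHull_pair, segment_eq_Icc (by linarith)]
      exact ⟨Int.floor_le _, (Int.lt_floor_add_one _).le⟩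
    refine convexHull_mono ?_ h1
    intro u hu
    have : ∀ i, ∃ z : ℤ, u i = z ∧ |(z : ℝ) - p * x i| ≤ 1 := fun i => by
      have h1 := Int.floor_le ((p : ℝ) * x i)
      have h2 := Int.lt_floor_add_one ((p : ℝ) * x i)
      rcases hu i trivial with h | h
      · exact ⟨_, h, by rw [abs_le]; constructor <;> linarith⟩
      · refine ⟨⌊p * x i⌋ + 1, by rw [h]; push_cast; rfl, ?_⟩
        push_cast
        rw [abs_le]; constructor <;> linarith
    choose z hz hz' using this
    exact ⟨1, one_pos, z, hT (hp x hx z hz'), by funext i; simp [toRealVec, hz]⟩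
  have hbT : Bornology.IsBounded (closure (convexHull ℝ (slopes T))) :=
    (isBounded_convexHull.2 hTb).closure
  have h2 : MeasureTheory.volume.real ((p : ℝ) • K) ≤ slopeVolume T :=
    MeasureTheory.measureReal_mono (hsub.trans subset_closure) hbT.measure_lt_top.ne
  rw [MeasureTheory.measureReal_def, MeasureTheory.Measure.addHaar_smul, ENNReal.toReal_mul,
    ENNReal.toReal_ofReal (abs_nonneg _), Module.finrank_fin_fun, abs_of_nonneg (by positivity)] at h2
  refine le_trans ?_ h2
  rw [mul_comm]
  gcongr
  exact hKv.le

end IsGradedSemigroup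

section Leaves

variable {k A Γ₀ : Type*} [Field k] [CommRing A] [Algebra k A] [LinearOrderedCommGroupWithZero Γ₀]
  {w : Valuation A Γ₀}

theorem Valuation.map_algebraMap_eq_one_of_le (hw : ∀ c : k, w (algebraMap k A c) ≤ 1) {c : k}
    (hc : c ≠ 0) : w (algebraMap k A c) = 1 := by
  refine le_antisymm (hw c) ?_
  have h1 : w (algebraMap k A c) * w (algebraMap k A c⁻¹) = 1 := by
    rw [← map_mul, ← map_mul, mul_inv_cancel₀ hc, map_one, map_one]
  calc (1 : Γ₀) = w (algebraMap k A c) * w (algebraMap k A c⁻¹) := h1.symm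
    _ ≤ w (algebraMap k A c) * 1 := by gcongr; exact hw _
    _ = _ := mul_one _

theorem Valuation.map_smul_le (hw : ∀ c : k, w (algebraMap k A c) ≤ 1) (c : k) (f : A) :
    w (c • f) ≤ w f := by
  rw [Algebra.smul_def, map_mul]
  exact mul_le_of_le_one_left' (hw c)

theorem LeafIndependent.mul_left {D : ℕ} {f : Fin D → A} (hf : LeafIndependent k w f) {g : A}
    (hg : w g ≠ 0) : LeafIndependent k w fun i => g * f i := by
  obtain ⟨γ, hγ, h⟩ := hf
  refine ⟨w g * γ, mul_ne_zero hg hγ, fun c hc => ?_⟩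
  rw [← h c hc, ← map_mul, Finset.mul_sum]
  simp_rw [mul_smul_comm]

/-- The elements of a subspace whose valuation is smaller than `γ`. -/
def Submodule.valuationLt (hw : ∀ c : k, w (algebraMap k A c) ≤ 1) (V : Submodule k A) (γ : Γ₀)
    (hγ : 0 < γ) : Submodule k A where
  carrier := {f | f ∈ V ∧ w f < γ}
  add_mem' := fun ha hb => ⟨V.add_mem ha.1 hb.1, w.map_add_lt ha.2 hb.2⟩
  zero_mem' := ⟨V.zero_mem, by simpa using hγ⟩
  smul_mem' := fun c _ ha => ⟨V.smul_mem c ha.1, (w.map_smul_le hw c _).trans_lt ha.2⟩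

theorem rank_le_of_not_leafIndependent (hw : ∀ c : k, w (algebraMap k A c) ≤ 1)
    (hw0 : ∀ f, w f = 0 ↔ f = 0) (D : ℕ) (T : Finset Γ₀) :
    ∀ V : Submodule k A, (∀ f ∈ V, f ≠ 0 → w f ∈ T) →
      (∀ f : Fin (D + 1) → A, (∀ i, f i ∈ V) → ¬ LeafIndependent k w f) →
      Module.rank k V ≤ (D * T.card : ℕ) := by
  classical
  induction T using Finset.induction_on_max with
  | empty =>
    intro V hV _
    have : V = ⊥ := by
      rw [eq_bot_iff]
      intro f hf
      by_contra h
      simpa using hV f hf h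
    subst this
    simp
  | insert γ T hT ih =>
    intro V hV hD
    have hγT : γ ∉ T := fun h => lt_irrefl _ (hT γ h)
    rcases eq_or_lt_of_le (zero_le (a := γ) : 0 ≤ γ) with h0 | h0
    · have h1 := ih V (fun f hf hf0 => by
        have h2 := hV f hf hf0
        rw [Finset.mem_insert] at h2
        refine h2.resolve_left fun h3 => hf0 ?_
        rw [← hw0, h3, h0]) hD
      refine h1.trans ?_
      rw [Finset.card_insert_of_notMem hγT]
      exact_mod_cast Nat.mul_le_mul_left _ (Nat.le_succ _)
    let V' := V.valuationLt hw γ h0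
    have hV'V : V' ≤ V := fun f hf => hf.1
    have h1 := ih V' (fun f hf hf0 => by
        have h2 := hV f hf.1 hf0
        rw [Finset.mem_insert] at h2
        exact h2.resolve_left hf.2.ne) (fun f hf => hD f fun i => hV'V (hf i))
    let Q := V'.comap V.subtype
    have h2 : Module.rank k Q ≤ (D * T.card : ℕ) := by
      rw [LinearEquiv.rank_eq (Submodule.comapSubtypeEquivOfLe hV'V)]
      exact h1
    have h3 : Module.rank k (V ⧸ Q) ≤ D := by
      refine rank_le fun s hs => ?_
      by_contra hlt
      rw [not_le] at hlt
      obtain ⟨e⟩ : Nonempty (Fin (D + 1) ↪ s) := by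
        rw [Function.Embedding.nonempty_iff_card_le]; simpa using hlt
      have hli := hs.comp e e.injective
      rw [Fintype.linearIndependent_iff] at hli
      choose g hg using fun i => Submodule.Quotient.mk_surjective Q ((e i : s) : V ⧸ Q)
      refine hD (fun i => g i) (fun i => (g i).2) ⟨γ, h0.ne', fun c hc => ?_⟩
      have hmem : ∑ i, c i • (g i : A) ∈ V := Submodule.sum_mem _ fun i _ => V.smul_mem _ (g i).2
      have hnot : ∑ i, c i • (g i : A) ∉ V' := fun hin => by
        apply hc
        funext j
        refine hli c ?_ j
        have : Submodule.Quotient.mk (p := Q) (∑ i, c i • g i) = 0 := by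
          rw [Submodule.Quotient.mk_eq_zero]
          simpa [Q] using hin
        rw [← this, ← Submodule.mkQ_apply, map_sum]
        refine Finset.sum_congr rfl fun i _ => ?_
        rw [map_smul, Submodule.mkQ_apply, hg]; rfl
      have hne : ∑ i, c i • (g i : A) ≠ 0 := fun h => hnot (h ▸ V'.zero_mem)
      have h4 := hV _ hmem hne
      rw [Finset.mem_insert] at h4
      refine h4.resolve_right fun h5 => hnot ⟨hmem, hT _ h5⟩
    rw [← Submodule.rank_quotient_add_rank Q, Finset.card_insert_of_notMem hγT]
    calc _ ≤ ((D : ℕ) : Cardinal) + (D * T.card : ℕ) := add_le_add h3 h2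
      _ = _ := by push_cast; ring

theorem linearIndependent_of_leaves (hw0 : ∀ f, w f = 0 ↔ f = 0) {I : Type*} {D : ℕ}
    (γ : I → Γ₀) (hγ : Function.Injective γ) (hγ0 : ∀ i, γ i ≠ 0) (f : I → Fin D → A)
    (hf : ∀ i, ∀ c : Fin D → k, c ≠ 0 → w (∑ j, c j • f i j) = γ i) :
    LinearIndependent k fun x : I × Fin D => f x.1 x.2 := by
  classical
  rw [linearIndependent_iff']
  intro s c hc
  let s' := s.image Prod.fst
  let c' : I × Fin D → k := fun x => if x ∈ s then c x else 0
  have h0 : ∑ i ∈ s', ∑ j, c' (i, j) • f i j = 0 := by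
    rw [← Finset.sum_product', ← hc]
    symm
    refine Finset.sum_subset_zero_on_sdiff ?_ ?_ ?_
    · intro x hx
      simp only [Finset.mem_product, Finset.mem_univ, and_true]
      exact Finset.mem_image_of_mem _ hx
    · intro x hx
      simp [c', (Finset.mem_sdiff.1 hx).2]
    · intro x hx
      simp [c', hx]
  have hcomb : ∀ i, (∑ j, c' (i, j) • f i j) ≠ 0 → w (∑ j, c' (i, j) • f i j) = γ i := by
    intro i hi
    refine hf i (fun j => c' (i, j)) fun h => hi ?_
    refine Finset.sum_eq_zero fun j _ => ?_
    have := congrFun h j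
    simp only [Pi.zero_apply] at this
    rw [this, zero_smul]
  intro x hx
  by_contra hcx
  have hne : (∑ j, c' (x.1, j) • f x.1 j) ≠ 0 := by
    intro h
    have := hf x.1 (fun j => c' (x.1, j)) (fun h' => by
      have := congrFun h' x.2
      simp [c', hx, hcx] at this)
    rw [h, map_zero] at this
    exact hγ0 _ this.symm
  obtain ⟨i, -, j, -, hij, hi, hj, heq⟩ := Valuation.exists_ne_map_eq_of_sum_eq_zero w hw0 s' _ h0
    ⟨x.1, Finset.mem_image_of_mem _ hx, hne⟩
  rw [hcomb i hi, hcomb j hj] at heq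
  exact hij (hγ heq)

end Leaves

/-- The values of the nonzero elements of a graded family of subspaces, in the coordinates given by
`ι` and the base point `g₀` in degree one. -/
def valueSemigroup {k A : Type*} [Field k] [CommRing A] [Algebra k A] {N d : ℕ} (ν : A → Fin N → ℤ)
    (ι : (Fin d → ℤ) →+ (Fin N → ℤ)) (g₀ : Fin N → ℤ) (V : ℕ → Submodule k A) (n : ℕ) :
    Set (Fin d → ℤ) :=
  {s | ∃ f ∈ V n, f ≠ 0 ∧ ν f = ι s + n • g₀}

section ValueSemigroup

variable {k A Γ₀ : Type*} [Field k] [CommRing A] [Algebra k A]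
  [LinearOrderedCommGroupWithZero Γ₀] {w : Valuation A Γ₀} {N d : ℕ} {ν : A → Fin N → ℤ}
  {ι : (Fin d → ℤ) →+ (Fin N → ℤ)} {g₀ : Fin N → ℤ} {V : ℕ → Submodule k A}

theorem IsValueVector.map_one [IsDomain A] (hν : IsValueVector k w ν) : ν 1 = 0 := by
  have := hν.mul 1 1 one_ne_zero one_ne_zero
  rw [mul_one] at this
  simpa using this

theorem isGradedSemigroup_valueSemigroup [IsDomain A] (hν : IsValueVector k w ν) (hV1 : (1 : A) ∈ V 0)
    (hVmul : ∀ i j, ∀ x ∈ V i, ∀ y ∈ V j, x * y ∈ V (i + j)) :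
    IsGradedSemigroup (valueSemigroup ν ι g₀ V) where
  zero_mem := ⟨1, hV1, one_ne_zero, by simp [hν.map_one]⟩
  add_mem := by
    rintro m n y z ⟨f, hf, hf0, hfy⟩ ⟨g, hg, hg0, hgz⟩
    refine ⟨f * g, hVmul _ _ _ hf _ hg, mul_ne_zero hf0 hg0, ?_⟩
    rw [hν.mul f g hf0 hg0, hfy, hgz, map_add, add_smul]
    abel

theorem finite_and_finrank_le (hν : IsValueVector k w ν)
    (hcov : ∀ n, ∀ f ∈ V n, f ≠ 0 → ∃ s, ν f = ι s + n • g₀) {D : ℕ}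
    (hD : ∀ n, ∀ f : Fin (D + 1) → A, (∀ i, f i ∈ V n) → ¬ LeafIndependent k w f) {n : ℕ}
    (hfin : (valueSemigroup ν ι g₀ V n).Finite) :
    Module.Finite k (V n) ∧ Module.finrank k (V n) ≤ D * (valueSemigroup ν ι g₀ V n).ncard := by
  classical
  let F : (Fin d → ℤ) → A := fun s =>
    if h : s ∈ valueSemigroup ν ι g₀ V n then h.choose else 0
  have hF : ∀ s ∈ valueSemigroup ν ι g₀ V n, F s ≠ 0 ∧ ν (F s) = ι s + n • g₀ := fun s h => by
    dsimp [F]; rw [dif_pos h]; exact h.choose_spec.2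
  let T := hfin.toFinset.image fun s => w (F s)
  have hT : T.card ≤ (valueSemigroup ν ι g₀ V n).ncard := by
    rw [Set.ncard_eq_toFinset_card _ hfin]; exact Finset.card_image_le
  have h := rank_le_of_not_leafIndependent hν.algebraMap_le hν.zero_iff D T (V n) (fun f hf hf0 => by
    obtain ⟨s, hs⟩ := hcov n f hf hf0
    have hsS : s ∈ valueSemigroup ν ι g₀ V n := ⟨f, hf, hf0, hs⟩
    refine Finset.mem_image.2 ⟨s, by simpa using hsS, ?_⟩
    exact (hν.eq_iff _ _ (hF s hsS).1 hf0).1 ((hF s hsS).2.trans hs.symm)) (hD n)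
  have hfinite : Module.Finite k (V n) :=
    Module.rank_lt_aleph0_iff.1 (h.trans_lt (Cardinal.natCast_lt_aleph0))
  refine ⟨hfinite, ?_⟩
  rw [← Module.finrank_eq_rank, Nat.cast_le] at h
  exact h.trans (Nat.mul_le_mul_left _ hT)

theorem mul_ncard_le_finrank (hν : IsValueVector k w ν) (hι : Function.Injective ι)
    (hVmul : ∀ i j, ∀ x ∈ V i, ∀ y ∈ V j, x * y ∈ V (i + j)) {D n₀ : ℕ} {u : Fin D → A}
    (hu : ∀ i, u i ∈ V n₀) (hul : LeafIndependent k w u) {n : ℕ}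
    (hfin : (valueSemigroup ν ι g₀ V n).Finite) [Module.Finite k (V (n + n₀))] :
    D * (valueSemigroup ν ι g₀ V n).ncard ≤ Module.finrank k (V (n + n₀)) := by
  classical
  obtain ⟨γ, hγ, hγu⟩ := hul
  have : Finite (valueSemigroup ν ι g₀ V n) := hfin
  have : Fintype (valueSemigroup ν ι g₀ V n) := Fintype.ofFinite _
  choose F hFV hF0 hFν using fun s : valueSemigroup ν ι g₀ V n => s.2
  have hli : LinearIndependent k fun x : valueSemigroup ν ι g₀ V n × Fin D => F x.1 * u x.2 := by
    refine linearIndependent_of_leaves hν.zero_iff (fun s => w (F s) * γ) ?_ ?_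
      (fun s j => F s * u j) ?_
    · intro s t hst
      have h1 : w (F s) = w (F t) := mul_right_cancel₀ hγ hst
      have h2 := (hν.eq_iff _ _ (hF0 s) (hF0 t)).2 h1
      rw [hFν, hFν] at h2
      exact Subtype.ext (hι (add_right_cancel h2))
    · exact fun s => mul_ne_zero (fun h => hF0 s ((hν.zero_iff _).1 h)) hγ
    · intro s c hc
      rw [← hγu c hc, ← map_mul, Finset.mul_sum]
      simp_rw [mul_smul_comm]
  have hli' : LinearIndependent k fun x : valueSemigroup ν ι g₀ V n × Fin D =>
      (⟨F x.1 * u x.2, hVmul _ _ _ (hFV _) _ (hu _)⟩ : V (n + n₀)) :=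
    LinearIndependent.of_comp (V (n + n₀)).subtype hli
  have := hli'.fintype_card_le_finrank
  rw [Fintype.card_prod, Fintype.card_fin, ← Nat.card_eq_fintype_card, Nat.card_coe_set_eq] at this
  rwa [mul_comm]

theorem tendsto_finrank_div_pow [IsDomain A] (hν : IsValueVector k w ν) (hι : Function.Injective ι)
    (hV1 : (1 : A) ∈ V 0) (hVmul : ∀ i j, ∀ x ∈ V i, ∀ y ∈ V j, x * y ∈ V (i + j))
    (hcov : ∀ n, ∀ f ∈ V n, f ≠ 0 → ∃ s, ν f = ι s + n • g₀)
    (hb : Bornology.IsBounded (slopes (valueSemigroup ν ι g₀ V)))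
    (hgen : Submodule.span ℤ (posElements (valueSemigroup ν ι g₀ V)) = ⊤) {D : ℕ}
    (hD : ∀ n, ∀ f : Fin (D + 1) → A, (∀ i, f i ∈ V n) → ¬ LeafIndependent k w f)
    (hD' : ∃ n₀, ∃ u : Fin D → A, (∀ i, u i ∈ V n₀) ∧ LeafIndependent k w u) :
    Tendsto (fun n : ℕ => (Module.finrank k (V n) : ℝ) / (n : ℝ) ^ d) atTop
      (𝓝 (D * slopeVolume (valueSemigroup ν ι g₀ V))) := by
  obtain ⟨n₀, u, hu, hul⟩ := hD'
  have hS : IsGradedSemigroup (valueSemigroup ν ι g₀ V) :=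
    isGradedSemigroup_valueSemigroup hν hV1 hVmul
  have hlim := hS.tendsto_ncard hgen hb
  rw [← tendsto_add_atTop_iff_nat n₀]
  have hup : Tendsto (fun n : ℕ => (D : ℝ) * (((valueSemigroup ν ι g₀ V (n + n₀)).ncard : ℝ) /
      ((n + n₀ : ℕ) : ℝ) ^ d)) atTop (𝓝 (D * slopeVolume (valueSemigroup ν ι g₀ V))) :=
    ((tendsto_add_atTop_iff_nat n₀).2 hlim).const_mul _
  have hratio : Tendsto (fun n : ℕ => ((n : ℝ) / ((n + n₀ : ℕ) : ℝ)) ^ d) atTop (𝓝 1) := by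
    have : Tendsto (fun n : ℕ => (n : ℝ) / ((n + n₀ : ℕ) : ℝ)) atTop (𝓝 1) := by
      simpa using tendsto_natCast_div_add_atTop (n₀ : ℝ)
    simpa using this.pow d
  have hlow : Tendsto (fun n : ℕ => (D : ℝ) * (((valueSemigroup ν ι g₀ V n).ncard : ℝ) /
      (n : ℝ) ^ d) * ((n : ℝ) / ((n + n₀ : ℕ) : ℝ)) ^ d) atTop
      (𝓝 (D * slopeVolume (valueSemigroup ν ι g₀ V))) := by
    simpa using (hlim.const_mul (D : ℝ)).mul hratio
  refine tendsto_of_tendsto_of_tendsto_of_le_of_le' hlow hup ?_ ?_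
  · filter_upwards [eventually_gt_atTop 0] with n hn
    have hf := IsGradedSemigroup.finite hb hn
    have : Module.Finite k (V (n + n₀)) := (finite_and_finrank_le hν hcov hD
      (IsGradedSemigroup.finite hb (Nat.add_pos_left hn _))).1
    have h := mul_ncard_le_finrank hν hι hVmul hu hul hf
    have h' : (D : ℝ) * (valueSemigroup ν ι g₀ V n).ncard ≤ Module.finrank k (V (n + n₀)) := by
      exact_mod_cast h
    have hn' : (n : ℝ) ^ d ≠ 0 := by positivity
    calc _ = (D : ℝ) * (valueSemigroup ν ι g₀ V n).ncard / ((n + n₀ : ℕ) : ℝ) ^ d := by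
          rw [div_pow]; field_simp
      _ ≤ _ := by gcongr
  · filter_upwards [eventually_gt_atTop 0] with n hn
    have h := (finite_and_finrank_le hν hcov hD
      (IsGradedSemigroup.finite hb (Nat.add_pos_left hn n₀))).2
    have h' : (Module.finrank k (V (n + n₀)) : ℝ) ≤
      D * (valueSemigroup ν ι g₀ V (n + n₀)).ncard := by exact_mod_cast h
    rw [← mul_div_assoc]
    gcongr

end ValueSemigroup

theorem exists_abs_le_of_injective {d N : ℕ} (ι : (Fin d → ℤ) →ₗ[ℤ] (Fin N → ℤ))
    (hι : Function.Injective ι) :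
    ∃ K : ℝ, ∀ (s : Fin d → ℤ) (R : ℝ), (∀ j, |(ι s j : ℝ)| ≤ R) → ∀ i, |(s i : ℝ)| ≤ K * R := by
  let b : Fin d → Fin N → ℚ := fun i j => ι (Pi.single i 1) j
  have hιs : ∀ (s : Fin d → ℤ) (j : Fin N), ι s j = ∑ i, s i * ι (Pi.single i 1) j := fun s j => by
    conv_lhs => rw [pi_eq_sum_univ' s]
    simp only [map_sum, map_smul, Finset.sum_apply, Pi.smul_apply, smul_eq_mul]
  have hb : LinearIndependent ℤ b := by
    rw [Fintype.linearIndependent_iff]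
    intro g hg
    have h0 : ι g = 0 := by
      funext j
      have := congrFun hg j
      simp only [Finset.sum_apply, b, zsmul_eq_mul, Pi.mul_apply, Pi.intCast_apply,
        Pi.zero_apply] at this
      rw [hιs, Pi.zero_apply]
      exact_mod_cast this
    have := hι (h0.trans (map_zero ι).symm)
    exact fun i => congrFun this i
  have hbQ : LinearIndependent ℚ b := (LinearIndependent.iff_fractionRing ℤ ℚ).1 hb
  have hinj := LinearMap.ker_eq_bot.2 hbQ.fintypeLinearCombination_injective
  obtain ⟨g, hg⟩ := LinearMap.exists_leftInverse_of_injective _ hinj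
  refine ⟨∑ i, ∑ j, |((g (Pi.single j 1) i : ℚ) : ℝ)|, fun s R hR i => ?_⟩
  have hs : (s i : ℚ) = ∑ j, (ι s j : ℚ) * g (Pi.single j 1) i := by
    have h1 := LinearMap.congr_fun hg (fun i => (s i : ℚ))
    have h2 : Fintype.linearCombination ℚ b (fun i => (s i : ℚ)) = fun j => (ι s j : ℚ) := by
      funext j
      rw [Fintype.linearCombination_apply, Finset.sum_apply, hιs]
      simp [b]
    rw [LinearMap.comp_apply, h2, LinearMap.id_apply] at h1
    have h3 := congrFun h1 i
    rw [← h3]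
    conv_lhs => rw [pi_eq_sum_univ' (fun j => (ι s j : ℚ))]
    simp [Finset.sum_apply]
  have hs' : (s i : ℝ) = ∑ j, (ι s j : ℝ) * ((g (Pi.single j 1) i : ℚ) : ℝ) := by
    exact_mod_cast congrArg (fun q : ℚ => (q : ℝ)) hs
  have hle : ∑ j, |((g (Pi.single j 1) i : ℚ) : ℝ)| ≤ ∑ i, ∑ j, |((g (Pi.single j 1) i : ℚ) : ℝ)| :=
    Finset.single_le_sum (f := fun i => ∑ j, |((g (Pi.single j 1) i : ℚ) : ℝ)|)
      (fun _ _ => Finset.sum_nonneg fun _ _ => abs_nonneg _) (Finset.mem_univ i)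
  rcases isEmpty_or_nonempty (Fin N) with hN | ⟨⟨j₀⟩⟩
  · rw [hs']; simp
  have hR0 : 0 ≤ R := (abs_nonneg _).trans (hR j₀)
  rw [hs']
  refine (Finset.abs_sum_le_sum_abs _ _).trans (le_trans ?_ (mul_le_mul_of_nonneg_right hle hR0))
  rw [Finset.sum_mul]
  refine Finset.sum_le_sum fun j _ => ?_
  rw [abs_mul, mul_comm]
  exact mul_le_mul_of_nonneg_left (hR j) (abs_nonneg _)

theorem exists_lattice_coordinates {k A Γ₀ : Type*} [Field k] [CommRing A] [IsDomain A] [Algebra k A]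
    [LinearOrderedCommGroupWithZero Γ₀] {w : Valuation A Γ₀} {N : ℕ} {ν : A → Fin N → ℤ}
    {V : ℕ → Submodule k A} (hν : IsValueVector k w ν)
    (hVmul : ∀ i j, ∀ x ∈ V i, ∀ y ∈ V j, x * y ∈ V (i + j))
    (hone : ∃ n, V n ≠ ⊥ ∧ V (n + 1) ≠ ⊥) {C : ℕ}
    (hC : ∀ n, ∀ f ∈ V n, f ≠ 0 → ∀ i, |ν f i| ≤ C * (n + 1)) :
    ∃ (d : ℕ) (ι : (Fin d → ℤ) →+ (Fin N → ℤ)) (g₀ : Fin N → ℤ), Function.Injective ι ∧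
      (∀ n, ∀ f ∈ V n, f ≠ 0 → ∃ s, ν f = ι s + n • g₀) ∧
      Submodule.span ℤ (posElements (valueSemigroup ν ι g₀ V)) = ⊤ ∧
      Bornology.IsBounded (slopes (valueSemigroup ν ι g₀ V)) := by
  obtain ⟨n₁, hn₁, hn₁'⟩ := hone
  obtain ⟨a, ha, ha0⟩ := Submodule.exists_mem_ne_zero_of_ne_bot hn₁
  obtain ⟨a', ha', ha0'⟩ := Submodule.exists_mem_ne_zero_of_ne_bot hn₁'
  let E : Set ((Fin N → ℤ) × ℤ) := {h | ∃ n : ℕ, 0 < n ∧ ∃ f ∈ V n, f ≠ 0 ∧ h = (ν f, (n : ℤ))}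
  let H : Submodule ℤ ((Fin N → ℤ) × ℤ) := Submodule.span ℤ E
  have hH : ∀ n, ∀ f ∈ V n, f ≠ 0 → (ν f, (n : ℤ)) ∈ H := by
    intro n f hf hf0
    have h1 : (ν (f * a'), ((n + (n₁ + 1) : ℕ) : ℤ)) ∈ H := Submodule.subset_span
      ⟨_, by omega, _, hVmul _ _ _ hf _ ha', mul_ne_zero hf0 ha0', rfl⟩
    have h2 : (ν a', ((n₁ + 1 : ℕ) : ℤ)) ∈ H := Submodule.subset_span
      ⟨_, by omega, _, ha', ha0', rfl⟩
    have h3 := H.sub_mem h1 h2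
    rw [hν.mul _ _ hf0 ha0'] at h3
    simpa using h3
  set g₀ : Fin N → ℤ := ν a' - ν a with hg₀
  have hg₀H : (g₀, (1 : ℤ)) ∈ H := by
    have := H.sub_mem (hH _ _ ha' ha0') (hH _ _ ha ha0)
    simpa using this
  let H₀ : Submodule ℤ (Fin N → ℤ) := H.comap (LinearMap.inl ℤ (Fin N → ℤ) ℤ)
  have hH₀ : ∀ x, x ∈ H₀ ↔ (x, (0 : ℤ)) ∈ H := fun x => Iff.rfl
  let b := Module.finBasis ℤ H₀
  let d := Module.finrank ℤ H₀
  let ι : (Fin d → ℤ) →ₗ[ℤ] (Fin N → ℤ) := H₀.subtype ∘ₗ (b.equivFun.symm : (Fin d → ℤ) →ₗ[ℤ] H₀)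
  have hι : Function.Injective ι := Subtype.val_injective.comp b.equivFun.symm.injective
  have hιmem : ∀ s, (ι s, (0 : ℤ)) ∈ H := fun s => (b.equivFun.symm s).2
  have hιsurj : ∀ x, (x, (0 : ℤ)) ∈ H → ∃ s, ι s = x := fun x hx =>
    ⟨b.equivFun ⟨x, hx⟩, by simp [ι]⟩
  have hcov : ∀ n, ∀ f ∈ V n, f ≠ 0 → ∃ s, ν f = ι s + n • g₀ := by
    intro n f hf hf0
    have h := H.sub_mem (hH n f hf hf0) (H.smul_mem (n : ℤ) hg₀H)
    obtain ⟨s, hs⟩ := hιsurj (ν f - n • g₀) (by simpa using h)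
    exact ⟨s, by rw [hs]; abel⟩
  refine ⟨d, ι.toAddMonoidHom, g₀, hι, hcov, ?_, ?_⟩
  · let φ : ((Fin d → ℤ) × ℤ) →ₗ[ℤ] ((Fin N → ℤ) × ℤ) :=
      (ι.coprod (LinearMap.toSpanSingleton ℤ _ g₀)).prod (LinearMap.snd ℤ _ _)
    have hφ : ∀ s n, φ (s, n) = (ι s + n • g₀, n) := fun s n => by simp [φ]
    have hφinj : Function.Injective φ := by
      rintro ⟨s, n⟩ ⟨s', n'⟩ h
      rw [hφ, hφ, Prod.mk.injEq] at h
      obtain ⟨h1, rfl⟩ := h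
      rw [hι (add_right_cancel h1)]
    have hmap : H ≤ (Submodule.span ℤ
        (posElements (valueSemigroup ν ι.toAddMonoidHom g₀ V))).map φ := by
      refine Submodule.span_le.2 ?_
      rintro _ ⟨n, hn, f, hf, hf0, rfl⟩
      obtain ⟨s, hs⟩ := hcov n f hf hf0
      refine ⟨(s, (n : ℤ)), Submodule.subset_span ⟨n, hn, rfl, f, hf, hf0, hs⟩, ?_⟩
      rw [hφ, hs]; simp
    rw [eq_top_iff]
    rintro ⟨s, n⟩ -
    have h1 : φ (s, n) ∈ H := by
      have := H.add_mem (hιmem s) (H.smul_mem n hg₀H)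
      rw [hφ]; simpa using this
    obtain ⟨x, hx, hxe⟩ := hmap h1
    rwa [← hφinj hxe]
  · obtain ⟨K, hK⟩ := exists_abs_le_of_injective ι hι
    let G : ℝ := ∑ j, |(g₀ j : ℝ)|
    have hG : ∀ j, |(g₀ j : ℝ)| ≤ G := fun j =>
      Finset.single_le_sum (f := fun j => |(g₀ j : ℝ)|) (fun _ _ => abs_nonneg _) (Finset.mem_univ j)
    rw [isBounded_iff_forall_norm_le]
    refine ⟨|K * (2 * C + G)|, ?_⟩
    rintro _ ⟨n, hn, s, ⟨f, hf, hf0, hfs⟩, rfl⟩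
    have hn1 : (1 : ℝ) ≤ n := by exact_mod_cast hn
    have h1 : ∀ j, |(ι s j : ℝ)| ≤ (2 * C + G) * n := fun j => by
      have h2 : ι s j = ν f j - n * g₀ j := by
        rw [hfs]; simp
      have h3 : |(ν f j : ℝ)| ≤ C * (n + 1) := by exact_mod_cast hC n f hf hf0 j
      rw [h2]; push_cast
      calc |(ν f j : ℝ) - n * g₀ j| ≤ |(ν f j : ℝ)| + |(n : ℝ) * g₀ j| := abs_sub _ _
        _ ≤ C * (n + 1) + n * G := by
          rw [abs_mul, Nat.abs_cast]
          gcongr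
          exact hG j
        _ ≤ (2 * C + G) * n := by nlinarith [(Nat.cast_nonneg C : (0 : ℝ) ≤ C)]
    have h2 := hK s _ h1
    rw [pi_norm_le_iff_of_nonneg (abs_nonneg _)]
    intro i
    have hn0 : (0 : ℝ) < n := by linarith
    rw [Pi.smul_apply, norm_smul, norm_inv, Real.norm_natCast, Real.norm_eq_abs,
      inv_mul_le_iff₀ hn0]
    refine (h2 i).trans ?_
    rw [← mul_assoc, mul_comm]
    gcongr
    exact le_abs_self _

section GradedSeries

variable {k A : Type*} [Field k] [CommRing A] [Algebra k A]

theorem exists_consecutive_of_closure_eq [IsDomain A] {L : ℕ → Submodule k A} (hL1 : (1 : A) ∈ L 0)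
    (hLmul : ∀ i j, ∀ x ∈ L i, ∀ y ∈ L j, x * y ∈ L (i + j)) {m : ℕ}
    (hidx : AddSubgroup.closure ((fun n : ℕ => (n : ℤ)) '' {n : ℕ | L n ≠ ⊥})
      = AddSubgroup.zmultiples (m : ℤ)) :
    (∀ n, L n ≠ ⊥ → m ∣ n) ∧ ∃ n, L (n * m) ≠ ⊥ ∧ L ((n + 1) * m) ≠ ⊥ := by
  have hdvd : ∀ n, L n ≠ ⊥ → m ∣ n := by
    intro n hn
    have : (n : ℤ) ∈ AddSubgroup.zmultiples (m : ℤ) := by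
      rw [← hidx]; exact AddSubgroup.subset_closure ⟨n, hn, rfl⟩
    rw [Int.mem_zmultiples_iff] at this
    exact_mod_cast this
  refine ⟨hdvd, ?_⟩
  have hadd : ∀ i j, L i ≠ ⊥ → L j ≠ ⊥ → L (i + j) ≠ ⊥ := by
    intro i j hi hj
    obtain ⟨x, hx, hx0⟩ := Submodule.exists_mem_ne_zero_of_ne_bot hi
    obtain ⟨y, hy, hy0⟩ := Submodule.exists_mem_ne_zero_of_ne_bot hj
    intro h
    have := hLmul i j x hx y hy
    rw [h, Submodule.mem_bot] at this
    exact mul_ne_zero hx0 hy0 this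
  have h0 : L 0 ≠ ⊥ := fun h => by
    rw [h, Submodule.mem_bot] at hL1
    exact one_ne_zero hL1
  have hdiff : ∀ z ∈ AddSubgroup.closure ((fun n : ℕ => (n : ℤ)) '' {n : ℕ | L n ≠ ⊥}),
      ∃ a b : ℕ, L a ≠ ⊥ ∧ L b ≠ ⊥ ∧ z = a - b := by
    intro z hz
    induction hz using AddSubgroup.closure_induction with
    | mem x hx =>
      obtain ⟨n, hn, rfl⟩ := hx
      exact ⟨n, 0, hn, h0, by simp⟩
    | zero => exact ⟨0, 0, h0, h0, by simp⟩
    | add x y _ _ hx hy =>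
      obtain ⟨a, b, ha, hb, rfl⟩ := hx
      obtain ⟨a', b', ha', hb', rfl⟩ := hy
      exact ⟨a + a', b + b', hadd _ _ ha ha', hadd _ _ hb hb', by push_cast; ring⟩
    | neg x _ hx =>
      obtain ⟨a, b, ha, hb, rfl⟩ := hx
      exact ⟨b, a, hb, ha, by ring⟩
  obtain ⟨a, b, ha, hb, hab⟩ := hdiff m (by rw [hidx]; exact AddSubgroup.mem_zmultiples _)
  obtain ⟨q, rfl⟩ := hdvd b hb
  refine ⟨q, by rwa [mul_comm], ?_⟩
  have : a = (q + 1) * m := by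
    zify; push_cast at hab; linarith
  rwa [← this]

theorem adjoin_inf_le (𝒜 : ℕ → Submodule k A) [GradedAlgebra 𝒜] {L : ℕ → Submodule k A}
    (hL : ∀ n, L n ≤ 𝒜 n) (hL1 : (1 : A) ∈ L 0)
    (hLmul : ∀ i j, ∀ x ∈ L i, ∀ y ∈ L j, x * y ∈ L (i + j)) (q n : ℕ) :
    Subalgebra.toSubmodule (Algebra.adjoin k (L q : Set A)) ⊓ 𝒜 n ≤ L n := by
  classical
  have hhom : ∀ i, ∀ x ∈ L i, ∀ j, (DirectSum.decompose 𝒜 x j : A) ∈ L j := by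
    intro i x hx j
    by_cases hij : i = j
    · subst hij
      rwa [DirectSum.decompose_of_mem_same 𝒜 (hL _ hx)]
    · rw [DirectSum.decompose_of_mem_ne 𝒜 (hL _ hx) hij]
      exact zero_mem _
  have key : ∀ x ∈ Algebra.adjoin k (L q : Set A), ∀ j, (DirectSum.decompose 𝒜 x j : A) ∈ L j := by
    intro x hx
    induction hx using Algebra.adjoin_induction with
    | mem x hx => exact hhom q x hx
    | algebraMap c =>
      refine hhom 0 _ ?_
      rw [Algebra.algebraMap_eq_smul_one]
      exact (L 0).smul_mem c hL1
    | add x y _ _ hx hy =>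
      intro j
      rw [DirectSum.decompose_add, DirectSum.add_apply, Submodule.coe_add]
      exact add_mem (hx j) (hy j)
    | mul x y _ _ hx hy =>
      intro j
      rw [DirectSum.decompose_mul, DirectSum.coe_mul_apply]
      refine Submodule.sum_mem _ fun ij hij => ?_
      rw [← (Finset.mem_filter.1 hij).2]
      exact hLmul _ _ _ (hx _) _ (hy _)
  rintro x ⟨hx, hxn⟩
  have := key x hx n
  rwa [DirectSum.decompose_of_mem_same 𝒜 hxn] at this

theorem exists_basis_posElements {d : ℕ} {S : ℕ → Set (Fin d → ℤ)}
    (hgen : Submodule.span ℤ (posElements S) = ⊤) :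
    ∃ b : Fin (d + 1) → (Fin d → ℤ) × ℤ, (∀ i, b i ∈ posElements S) ∧ LinearIndependent ℤ b := by
  let j : ((Fin d → ℤ) × ℤ) →ₗ[ℤ] ((Fin d → ℚ) × ℚ) :=
    (LinearMap.prodMap ((Algebra.linearMap ℤ ℚ).compLeft (Fin d)) (Algebra.linearMap ℤ ℚ))
  have hj : ∀ s n, j (s, n) = (fun i => (s i : ℚ), (n : ℚ)) := fun s n => rfl
  have hspan : Submodule.span ℚ (j '' posElements S) = ⊤ := by
    have h1 : ∀ x, j x ∈ Submodule.span ℚ (j '' posElements S) := by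
      intro x
      have hx : x ∈ Submodule.span ℤ (posElements S) := hgen ▸ Submodule.mem_top
      induction hx using Submodule.span_induction with
      | mem x hx => exact Submodule.subset_span ⟨x, hx, rfl⟩
      | zero => rw [map_zero]; exact zero_mem _
      | add x y _ _ hx hy => rw [map_add]; exact add_mem hx hy
      | smul a x _ hx =>
        rw [map_smul, ← Int.cast_smul_eq_zsmul ℚ]
        exact Submodule.smul_mem _ _ hx
    rw [eq_top_iff]
    rintro ⟨s, n⟩ -
    have h2 : (s, n) = ∑ i, s i • j (Pi.single i 1, 0) + n • j (0, 1) := by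
      refine Prod.ext_iff.2 ⟨?_, ?_⟩
      · funext i
        simp [hj, Prod.fst_sum, Finset.sum_apply, Pi.single_apply]
      · simp [hj, Prod.snd_sum]
    rw [h2]
    exact add_mem (Submodule.sum_mem _ fun i _ => Submodule.smul_mem _ _ (h1 _))
      (Submodule.smul_mem _ _ (h1 _))
  obtain ⟨b, hbs, hbspan, hbli⟩ := exists_linearIndependent ℚ (j '' posElements S)
  have B : Module.Basis b ℚ ((Fin d → ℚ) × ℚ) := Module.Basis.mk hbli (by
    rw [Subtype.range_coe, hbspan, hspan])
  have : Fintype b := FiniteDimensional.fintypeBasisIndex B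
  have hcard : Fintype.card b = d + 1 := by
    rw [← Module.finrank_eq_card_basis B]; simp
  let e : Fin (d + 1) ≃ b := (Fintype.equivFinOfCardEq hcard).symm
  choose g hg hgj using fun i => hbs (e i).2
  refine ⟨g, hg, ?_⟩
  have h1 : LinearIndependent ℚ fun i => j (g i) := by
    simp_rw [hgj]
    exact hbli.comp e e.injective
  have h2 : LinearIndependent ℤ (j ∘ g) := h1.restrict_scalars' ℤ
  exact h2.of_comp j

theorem exists_algebraicIndependent_of_span_eq_top {Γ₀ : Type*} [LinearOrderedCommGroupWithZero Γ₀]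
    [IsDomain A] {w : Valuation A Γ₀} {N d : ℕ} {ν : A → Fin N → ℤ}
    {ι : (Fin d → ℤ) →+ (Fin N → ℤ)} {g₀ : Fin N → ℤ} {V : ℕ → Submodule k A}
    (𝒜 : ℕ → Submodule k A) [GradedAlgebra 𝒜] {m : ℕ} (hm : 0 < m) (hV : ∀ n, V n ≤ 𝒜 (n * m))
    (hν : IsValueVector k w ν) (hι : Function.Injective ι)
    (hgen : Submodule.span ℤ (posElements (valueSemigroup ν ι g₀ V)) = ⊤) :
    ∃ f : Fin (d + 1) → A, (∀ l, ∃ n, 0 < n ∧ f l ∈ V n) ∧ AlgebraicIndependent k f := by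
  classical
  obtain ⟨b, hb, hbli⟩ := exists_basis_posElements hgen
  choose n hn hbn f hfV hf0 hfν using hb
  refine ⟨f, fun l => ⟨n l, hn l, hfV l⟩, ?_⟩
  rw [algebraicIndependent_iff]
  intro P hP
  let mon : (Fin (d + 1) →₀ ℕ) → A := fun e => ∏ i, f i ^ e i
  let wt : (Fin (d + 1) →₀ ℕ) → ℕ := fun e => ∑ i, e i * n i
  have hmon0 : ∀ e, mon e ≠ 0 := fun e => Finset.prod_ne_zero_iff.2 fun i _ => pow_ne_zero _ (hf0 i)
  have hmon𝒜 : ∀ e, mon e ∈ 𝒜 (wt e * m) := fun e => by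
    have h : mon e ∈ 𝒜 (∑ i, e i • (n i * m)) :=
      SetLike.prod_pow_mem_graded 𝒜 _ _ _ fun i _ => hV _ (hfV i)
    convert h using 2
    rw [Finset.sum_mul]
    exact Finset.sum_congr rfl fun i _ => by rw [smul_eq_mul, mul_assoc]
  have hνpow : ∀ g : A, g ≠ 0 → ∀ t : ℕ, ν (g ^ t) = t • ν g := fun g hg t => by
    induction t with
    | zero => simp [hν.map_one]
    | succ t ih => rw [pow_succ, hν.mul _ _ (pow_ne_zero _ hg) hg, ih, succ_nsmul]
  have hνprod : ∀ (s : Finset (Fin (d + 1))) (e : Fin (d + 1) →₀ ℕ),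
      ν (∏ i ∈ s, f i ^ e i) = ∑ i ∈ s, e i • ν (f i) := fun s e => by
    induction s using Finset.induction_on with
    | empty => simp [hν.map_one]
    | insert i s hi ih =>
      rw [Finset.prod_insert hi, Finset.sum_insert hi, hν.mul _ _ (pow_ne_zero _ (hf0 i))
        (Finset.prod_ne_zero_iff.2 fun i _ => pow_ne_zero _ (hf0 i)), ih, hνpow _ (hf0 i)]
  have hνmon : ∀ e, ν (mon e) = ι (∑ i, e i • (b i).1) + wt e • g₀ := fun e => by
    simp only [mon, wt]
    rw [hνprod, map_sum, Finset.sum_smul, ← Finset.sum_add_distrib]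
    refine Finset.sum_congr rfl fun i _ => ?_
    rw [hfν, smul_add, map_nsmul, mul_smul]
  have hmoninj : ∀ e e', wt e = wt e' → w (mon e) = w (mon e') → e = e' := by
    intro e e' hwt hw
    have h1 := (hν.eq_iff _ _ (hmon0 e) (hmon0 e')).2 hw
    rw [hνmon, hνmon, hwt] at h1
    have h2 := hι (add_right_cancel h1)
    have h3 : ∑ i, ((e i : ℤ) - e' i) • b i = 0 := by
      simp only [sub_smul, natCast_zsmul, Finset.sum_sub_distrib]
      rw [sub_eq_zero]
      refine Prod.ext_iff.2 ⟨?_, ?_⟩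
      · simpa only [Prod.fst_sum, Prod.smul_fst] using h2
      · simp only [Prod.snd_sum, Prod.smul_snd, hbn]
        simp only [nsmul_eq_mul]
        exact_mod_cast hwt
    ext i
    have := Fintype.linearIndependent_iff.1 hbli _ h3 i
    omega
  have hsum : ∑ e ∈ P.support, P.coeff e • mon e = 0 := by
    rw [← hP, MvPolynomial.aeval_def, MvPolynomial.eval₂_eq']
    exact Finset.sum_congr rfl fun e _ => Algebra.smul_def _ _
  by_contra hP0
  obtain ⟨e₀, he₀⟩ := MvPolynomial.support_nonempty.2 hP0
  have hsum' : ∑ e ∈ P.support.filter (fun e => wt e = wt e₀), P.coeff e • mon e = 0 := by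
    have h := congrArg (GradedAlgebra.proj 𝒜 (wt e₀ * m)) hsum
    rw [map_zero, map_sum] at h
    rw [Finset.sum_filter]
    refine Eq.trans ?_ h
    refine Finset.sum_congr rfl fun e _ => ?_
    rw [GradedAlgebra.proj_apply]
    split_ifs with hwt
    · rw [DirectSum.decompose_of_mem_same]
      rw [← hwt]
      exact Submodule.smul_mem _ _ (hmon𝒜 e)
    · rw [DirectSum.decompose_of_mem_ne 𝒜 (Submodule.smul_mem _ _ (hmon𝒜 e))]
      exact fun h => hwt (Nat.eq_of_mul_eq_mul_right hm h)
  have hc : ∀ e ∈ P.support, w (P.coeff e • mon e) = w (mon e) := fun e he => by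
    rw [Algebra.smul_def, map_mul, Valuation.map_algebraMap_eq_one_of_le hν.algebraMap_le
      (MvPolynomial.mem_support_iff.1 he), one_mul]
  obtain ⟨e, he, e', he', hne, -, -, heq⟩ := Valuation.exists_ne_map_eq_of_sum_eq_zero w hν.zero_iff
    _ _ hsum' ⟨e₀, by simp [he₀], fun h => MvPolynomial.mem_support_iff.1 he₀
      ((smul_eq_zero.1 h).resolve_right (hmon0 _))⟩
  rw [Finset.mem_filter] at he he'
  rw [hc _ he.1, hc _ he'.1] at heq
  exact hne (hmoninj _ _ (he.2.trans he'.2.symm) heq)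

end GradedSeries

section Counting

variable {k A : Type*} [Field k] [CommRing A] [Algebra k A] {V : ℕ → Submodule k A}

theorem exists_pow_le_finrank_of_algebraicIndependent (hV1 : (1 : A) ∈ V 0)
    (hVmul : ∀ i j, ∀ x ∈ V i, ∀ y ∈ V j, x * y ∈ V (i + j)) {κ : ℕ} {f : Fin (κ + 1) → A}
    (hf : ∀ l, ∃ n, 0 < n ∧ f l ∈ V n) (hind : AlgebraicIndependent k f) :
    ∃ M, 0 < M ∧ ∀ t, Module.Finite k (V (M * (κ * t))) →
      (t + 1) ^ κ ≤ Module.finrank k (V (M * (κ * t))) := by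
  classical
  choose n hn hfn using hf
  refine ⟨∏ i, n i, Finset.prod_pos fun i _ => hn i, fun t hfin => ?_⟩
  set M := ∏ i, n i
  have hdvd : ∀ i, n i ∣ M := fun i => Finset.dvd_prod_of_mem _ (Finset.mem_univ i)
  have hM : 0 < M := Finset.prod_pos fun i _ => hn i
  let e : (Fin κ → Fin (t + 1)) → Fin (κ + 1) → ℕ := fun x =>
    Fin.cons (κ * t - ∑ i, (x i : ℕ)) fun i => (x i : ℕ)
  have he : ∀ x, ∑ i, e x i = κ * t := fun x => by
    have h : ∑ i, (x i : ℕ) ≤ κ * t := by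
      refine (Finset.sum_le_card_nsmul _ _ t fun i _ => Nat.lt_succ_iff.1 (x i).2).trans ?_
      simp
    rw [Fin.sum_univ_succ]
    simp only [e, Fin.cons_zero, Fin.cons_succ]
    omega
  let a : (Fin κ → Fin (t + 1)) → (Fin (κ + 1) →₀ ℕ) := fun x =>
    Finsupp.equivFunOnFinite.symm fun i => M / n i * e x i
  have ha : Function.Injective a := fun x y hxy => by
    funext i
    have h : M / n i.succ * e x i.succ = M / n i.succ * e y i.succ :=
      DFunLike.congr_fun hxy i.succ
    have h' := Nat.eq_of_mul_eq_mul_left (Nat.div_pos (Nat.le_of_dvd hM (hdvd _)) (hn _)) h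
    simpa only [e, Fin.cons_succ, Fin.val_inj] using h'
  have hli : LinearIndependent k fun x => ∏ i, f i ^ a x i := by
    have h := ((MvPolynomial.basisMonomials (Fin (κ + 1)) k).linearIndependent.map'
      (MvPolynomial.aeval f : MvPolynomial (Fin (κ + 1)) k →ₐ[k] A).toLinearMap
      (LinearMap.ker_eq_bot.2 hind)).comp a ha
    have heq : (fun x => ∏ i, f i ^ a x i) = ((MvPolynomial.aeval f :
        MvPolynomial (Fin (κ + 1)) k →ₐ[k] A).toLinearMap ∘
          MvPolynomial.basisMonomials (Fin (κ + 1)) k) ∘ a := by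
      funext x
      simp [MvPolynomial.aeval_monomial, Finsupp.prod_fintype]
    rw [heq]
    exact h
  have : SetLike.GradedMonoid V :=
    { one_mem := hV1, mul_mem := fun i j _ _ hx hy => hVmul i j _ hx _ hy }
  have hmem : ∀ x, ∏ i, f i ^ a x i ∈ V (M * (κ * t)) := fun x => by
    have h : ∏ i, f i ^ a x i ∈ V (∑ i, a x i • n i) :=
      SetLike.prod_pow_mem_graded V _ _ _ fun i _ => hfn i
    convert h using 2
    rw [← he x, Finset.mul_sum]
    refine Finset.sum_congr rfl fun i _ => ?_
    change M * e x i = M / n i * e x i * n i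
    rw [mul_right_comm, Nat.div_mul_cancel (hdvd i)]
  have hli' : LinearIndependent k fun x => (⟨_, hmem x⟩ : V (M * (κ * t))) :=
    LinearIndependent.of_comp (V (M * (κ * t))).subtype hli
  simpa using hli'.fintype_card_le_finrank

theorem le_of_tendsto_finrank_div_pow (hV1 : (1 : A) ∈ V 0)
    (hVmul : ∀ i j, ∀ x ∈ V i, ∀ y ∈ V j, x * y ∈ V (i + j))
    (hfin : ∀ n, 0 < n → Module.Finite k (V n)) {κ d : ℕ} {f : Fin (κ + 1) → A}
    (hf : ∀ l, ∃ n, 0 < n ∧ f l ∈ V n) (hind : AlgebraicIndependent k f) {v : ℝ}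
    (hlim : Tendsto (fun n : ℕ => (Module.finrank k (V n) : ℝ) / (n : ℝ) ^ d) atTop (𝓝 v)) :
    κ ≤ d := by
  by_contra! hlt
  obtain ⟨M, hM, hMt⟩ := exists_pow_le_finrank_of_algebraicIndependent hV1 hVmul hf hind
  obtain ⟨B, hB⟩ := hlim.bddAbove_range
  obtain ⟨t, ht⟩ := exists_nat_gt (max 0 (B * ((M * κ : ℕ) : ℝ) ^ d))
  have ht0 : 0 < t := by exact_mod_cast (le_max_left _ _).trans_lt ht
  have hκ : 0 < κ := by omega
  have hpos : 0 < M * (κ * t) := by positivity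
  have h1 := hMt t (hfin _ hpos)
  have h2 := hB ⟨M * (κ * t), rfl⟩
  simp only at h2
  rw [div_le_iff₀ (by positivity)] at h2
  have h3 : ((t : ℝ) + 1) ^ κ ≤ Module.finrank k (V (M * (κ * t))) := by exact_mod_cast h1
  have h4 : (t : ℝ) ^ d * t ≤ ((t : ℝ) + 1) ^ κ := by
    rw [← pow_succ]
    calc (t : ℝ) ^ (d + 1) ≤ (t + 1) ^ (d + 1) := by gcongr; linarith
      _ ≤ _ := pow_le_pow_right₀ (by linarith [(Nat.cast_nonneg t : (0 : ℝ) ≤ t)]) hlt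
  have h5 : B * ((M * (κ * t) : ℕ) : ℝ) ^ d = (t : ℝ) ^ d * (B * ((M * κ : ℕ) : ℝ) ^ d) := by
    push_cast; ring
  have h6 : (t : ℝ) ^ d * (B * ((M * κ : ℕ) : ℝ) ^ d) < (t : ℝ) ^ d * t := by
    have := (le_max_right _ _).trans_lt ht
    gcongr
  linarith

end Counting

section Subfamily

open Pointwise in
theorem slopes_subset_smul {d p : ℕ} (hp : 0 < p) {S T : ℕ → Set (Fin d → ℤ)}
    (hTS : ∀ n, T n ⊆ S (n * p)) : slopes T ⊆ (p : ℝ) • slopes S := by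
  rintro _ ⟨n, hn, s, hs, rfl⟩
  refine ⟨_, ⟨n * p, Nat.mul_pos hn hp, s, hTS n hs, rfl⟩, ?_⟩
  have : (p : ℝ) ≠ 0 := by positivity
  simp only [smul_smul]
  congr 1
  push_cast
  field_simp

theorem isBounded_slopes_of_subset {d p : ℕ} (hp : 0 < p) {S T : ℕ → Set (Fin d → ℤ)}
    (hTS : ∀ n, T n ⊆ S (n * p)) (hb : Bornology.IsBounded (slopes S)) :
    Bornology.IsBounded (slopes T) :=
  (hb.smul₀ (p : ℝ)).subset (slopes_subset_smul hp hTS)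

open Pointwise in
theorem slopeVolume_le_of_subset {d p : ℕ} (hp : 0 < p) {S T : ℕ → Set (Fin d → ℤ)}
    (hTS : ∀ n, T n ⊆ S (n * p)) (hb : Bornology.IsBounded (slopes S)) :
    slopeVolume T ≤ (p : ℝ) ^ d * slopeVolume S := by
  have hp' : (p : ℝ) ≠ 0 := by positivity
  have hbc : Bornology.IsBounded (closure (convexHull ℝ (slopes S))) :=
    (isBounded_convexHull.2 hb).closure
  have hsub : closure (convexHull ℝ (slopes T)) ⊆
      (p : ℝ) • closure (convexHull ℝ (slopes S)) := by
    rw [← closure_smul₀' hp', ← convexHull_smul]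
    exact closure_mono (convexHull_mono (slopes_subset_smul hp hTS))
  have hvol : MeasureTheory.volume.real ((p : ℝ) • closure (convexHull ℝ (slopes S)))
      = (p : ℝ) ^ d * slopeVolume S := by
    rw [slopeVolume, MeasureTheory.measureReal_def, MeasureTheory.Measure.addHaar_smul,
      ENNReal.toReal_mul, ENNReal.toReal_ofReal (abs_nonneg _), MeasureTheory.measureReal_def]
    simp
  rw [← hvol]
  exact MeasureTheory.measureReal_mono hsub (hbc.smul₀ (p : ℝ)).measure_lt_top.ne

theorem slopeVolume_eq_zero {d : ℕ} {S : ℕ → Set (Fin d → ℤ)}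
    (h : ¬ (interior (convexHull ℝ (slopes S))).Nonempty) : slopeVolume S = 0 := by
  rw [slopeVolume, closure_eq_interior_union_frontier, Set.not_nonempty_iff_eq_empty.1 h,
    Set.empty_union, MeasureTheory.measureReal_def,
    (convex_convexHull ℝ (slopes S)).addHaar_frontier MeasureTheory.volume, ENNReal.toReal_zero]

variable {k A Γ₀ : Type*} [Field k] [CommRing A] [Algebra k A]
  [LinearOrderedCommGroupWithZero Γ₀] {w : Valuation A Γ₀} {N d : ℕ} {ν : A → Fin N → ℤ}
  {ι : (Fin d → ℤ) →+ (Fin N → ℤ)} {g₀ : Fin N → ℤ} {V : ℕ → Submodule k A}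

theorem exists_tendsto_finrank_subfamilies [IsDomain A] (hν : IsValueVector k w ν)
    (hι : Function.Injective ι)
    (hV1 : (1 : A) ∈ V 0) (hVmul : ∀ i j, ∀ x ∈ V i, ∀ y ∈ V j, x * y ∈ V (i + j))
    (hcov : ∀ n, ∀ f ∈ V n, f ≠ 0 → ∃ s, ν f = ι s + n • g₀)
    (hb : Bornology.IsBounded (slopes (valueSemigroup ν ι g₀ V)))
    (hgen : Submodule.span ℤ (posElements (valueSemigroup ν ι g₀ V)) = ⊤) {D : ℕ}
    (hD : ∀ n, ∀ f : Fin (D + 1) → A, (∀ i, f i ∈ V n) → ¬ LeafIndependent k w f)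
    (hD' : ∃ n₀, ∃ u : Fin D → A, (∀ i, u i ∈ V n₀) ∧ LeafIndependent k w u)
    {W : ℕ → ℕ → Submodule k A} (hW1 : ∀ p, (1 : A) ∈ W p 0)
    (hWmul : ∀ p i j, ∀ x ∈ W p i, ∀ y ∈ W p j, x * y ∈ W p (i + j))
    (hWV : ∀ p n, W p n ≤ V (n * p)) (hVW : ∀ p, V p ≤ W p 1) :
    ∃ (p₀ : ℕ) (c : ℕ → ℝ),
      (∀ p, p₀ ≤ p → Tendsto (fun n : ℕ => (Module.finrank k (W p n) : ℝ) / (n : ℝ) ^ d)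
        atTop (𝓝 (c p))) ∧
      Tendsto (fun p : ℕ => c p / (p : ℝ) ^ d) atTop
        (𝓝 (D * slopeVolume (valueSemigroup ν ι g₀ V))) := by
  have hS : IsGradedSemigroup (valueSemigroup ν ι g₀ V) :=
    isGradedSemigroup_valueSemigroup hν hV1 hVmul
  by_cases hne : (interior (convexHull ℝ (slopes (valueSemigroup ν ι g₀ V)))).Nonempty
  · let T : ℕ → ℕ → Set (Fin d → ℤ) := fun p => valueSemigroup ν ι (p • g₀) (W p)
    have hTS : ∀ p n, T p n ⊆ valueSemigroup ν ι g₀ V (n * p) := by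
      rintro p n s ⟨f, hf, hf0, hfν⟩
      exact ⟨f, hWV p n hf, hf0, by rw [hfν, mul_smul]⟩
    have hST : ∀ p, valueSemigroup ν ι g₀ V p ⊆ T p 1 := by
      rintro p s ⟨f, hf, hf0, hfν⟩
      exact ⟨f, hVW p hf, hf0, by rw [hfν, one_smul]⟩
    obtain ⟨n₀, u, hu, hul⟩ := hD'
    have hev := hS.eventually_span_eq_top hgen hne
    have hev' : ∀ᶠ p : ℕ in atTop, (valueSemigroup ν ι g₀ V (p - n₀)).Nonempty :=
      (tendsto_sub_atTop_nat n₀).eventually (hev.mono fun p hp => hp.1)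
    obtain ⟨p₀, hp₀⟩ := eventually_atTop.1
      (hev.and (hev'.and ((eventually_ge_atTop n₀).and (eventually_gt_atTop 0))))
    refine ⟨p₀, fun p => D * slopeVolume (T p), fun p hp => ?_, ?_⟩
    · obtain ⟨⟨-, hspan⟩, ⟨s, g, hg, hg0, -⟩, hn₀, hp0⟩ := hp₀ p hp
      refine tendsto_finrank_div_pow hν hι (hW1 p) (hWmul p) (fun n f hf hf0 => ?_)
        (isBounded_slopes_of_subset hp0 (hTS p) hb) (hspan _ (hST p))
        (fun n f hf => hD (n * p) f fun i => hWV p n (hf i))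
        ⟨1, fun i => g * u i, fun i => hVW p ?_, hul.mul_left fun h => hg0 ((hν.zero_iff g).1 h)⟩
      · obtain ⟨s, hs⟩ := hcov _ f (hWV p n hf) hf0
        exact ⟨s, by rw [hs, mul_smul]⟩
      · have := hVmul _ _ g hg _ (hu i)
        rwa [Nat.sub_add_cancel hn₀] at this
    · simp_rw [mul_div_assoc]
      refine Tendsto.const_mul _ (tendsto_order.2 ⟨fun v hv => ?_, fun v hv => ?_⟩)
      · obtain ⟨v', hvv', hv'⟩ := exists_between hv
        filter_upwards [hS.eventually_le_slopeVolume hgen hb hv', eventually_gt_atTop 0] with p hp hp0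
        refine hvv'.trans_le ?_
        rw [le_div_iff₀ (by positivity)]
        exact hp _ (isBounded_slopes_of_subset hp0 (hTS p) hb) (hST p)
      · filter_upwards [eventually_gt_atTop 0] with p hp0
        refine lt_of_le_of_lt ?_ hv
        rw [div_le_iff₀ (by positivity), mul_comm]
        exact slopeVolume_le_of_subset hp0 (hTS p) hb
  · have hlim := tendsto_finrank_div_pow hν hι hV1 hVmul hcov hb hgen hD hD'
    rw [slopeVolume_eq_zero hne, mul_zero] at hlim ⊢
    refine ⟨1, fun _ => 0, fun p hp => ?_, by simp⟩
    have hlim' : Tendsto (fun n : ℕ => (Module.finrank k (V (n * p)) : ℝ) /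
        ((n * p : ℕ) : ℝ) ^ d * (p : ℝ) ^ d) atTop (𝓝 0) := by
      simpa using (hlim.comp (tendsto_id.atTop_mul_const' hp)).mul_const ((p : ℝ) ^ d)
    refine tendsto_of_tendsto_of_tendsto_of_le_of_le' tendsto_const_nhds hlim'
      (Eventually.of_forall fun n => by positivity) ?_
    filter_upwards [eventually_gt_atTop 0] with n hn
    have hfin : Module.Finite k (V (n * p)) :=
      (finite_and_finrank_le hν hcov hD (IsGradedSemigroup.finite hb (Nat.mul_pos hn hp))).1
    have h : (Module.finrank k (W p n) : ℝ) ≤ Module.finrank k (V (n * p)) := by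
      exact_mod_cast Submodule.finrank_mono (hWV p n)
    have hp' : (p : ℝ) ^ d ≠ 0 := by positivity
    rw [Nat.cast_mul, mul_pow, ← div_div, div_mul_cancel₀ _ hp']
    gcongr

end Subfamily

/-- Volume = multiplicity for graded linear series.  Let `k` be a field and `A = ⊕_{n≥0} A_n`
an `ℕ`-graded commutative domain which is a finitely generated `k`-algebra with `A_0` finite
dimensional over `k` and `A` generated by `A_1` as an `A_0`-algebra.  Let `L = ⊕ L_n` be a
graded `k`-subalgebra of `A` of Kodaira–Iitaka dimension `κ = κ(L) ≥ 0` and index `m = m(L)`.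
For `p ≥ 1` let `k[L_{pm}]` be the `k`-subalgebra of `A` generated by `L_{pm}`.  Then for all
sufficiently large `p` the limit `c_p = lim_{n→∞} dim_k (k[L_{pm}])_{npm}/n^κ` exists, and
`lim_{p→∞} c_p/p^κ = lim_{n→∞} dim_k L_{nm}/n^κ`, both outer limits existing. -/
theorem statement16 (k : Type*) [Field k] (A : Type*) [CommRing A] [IsDomain A] [Algebra k A]
    (𝒜 : ℕ → Submodule k A) [GradedAlgebra 𝒜]
    (hFT : Algebra.FiniteType k A)
    (hA0 : FiniteDimensional k ↥(𝒜 0))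
    (hgen : Algebra.adjoin k ((𝒜 0 : Set A) ∪ (𝒜 1 : Set A)) = ⊤)
    (L : ℕ → Submodule k A) (hL : ∀ n, L n ≤ 𝒜 n) (hL1 : (1 : A) ∈ L 0)
    (hLmul : ∀ i j, ∀ x ∈ L i, ∀ y ∈ L j, x * y ∈ L (i + j))
    (κ : ℕ)
    (hκ1 : ∃ f : Fin (κ + 1) → A,
      (∀ l, ∃ n, 0 < n ∧ f l ∈ L n) ∧ AlgebraicIndependent k f)
    (hκ2 : ¬ ∃ f : Fin (κ + 2) → A,
      (∀ l, ∃ n, 0 < n ∧ f l ∈ L n) ∧ AlgebraicIndependent k f)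
    (m : ℕ) (hm : 0 < m)
    (hidx : AddSubgroup.closure ((fun n : ℕ => (n : ℤ)) '' {n : ℕ | L n ≠ ⊥})
      = AddSubgroup.zmultiples (m : ℤ)) :
    ∃ (p₀ : ℕ) (c : ℕ → ℝ) (V : ℝ),
      (∀ p, p₀ ≤ p → Tendsto (fun n : ℕ =>
          (Module.finrank k
            ↥(Subalgebra.toSubmodule (Algebra.adjoin k ((L (p * m) : Set A)))
              ⊓ 𝒜 (n * (p * m))) : ℝ) / (n : ℝ) ^ κ)
        atTop (𝓝 (c p))) ∧
      Tendsto (fun n : ℕ => (Module.finrank k ↥(L (n * m)) : ℝ) / (n : ℝ) ^ κ)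
        atTop (𝓝 V) ∧
      Tendsto (fun p : ℕ => c p / (p : ℝ) ^ κ) atTop (𝓝 V) := by
  obtain ⟨Γ₀, _, w, N, ν, C, r, hν, hC, hr⟩ := exists_isValueVector 𝒜 hFT hA0
  obtain ⟨hdvd, hone⟩ := exists_consecutive_of_closure_eq hL1 hLmul hidx
  let V : ℕ → Submodule k A := fun n => L (n * m)
  have hV1 : (1 : A) ∈ V 0 := by simpa [V] using hL1
  have hVmul : ∀ i j, ∀ x ∈ V i, ∀ y ∈ V j, x * y ∈ V (i + j) := fun i j x hx y hy => by
    simpa only [V, add_mul] using hLmul _ _ x hx y hy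
  obtain ⟨d, ι, g₀, hι, hcov, hspan, hb⟩ := exists_lattice_coordinates (V := V) (C := C * m) hν hVmul
    hone fun n f hf hf0 i => (hC _ f (hL _ hf) hf0 i).trans <| by
      have hm' : (1 : ℤ) ≤ m := by exact_mod_cast hm
      have hC' : (0 : ℤ) ≤ C := Int.natCast_nonneg _
      push_cast
      nlinarith [mul_nonneg hC' (sub_nonneg.2 hm')]
  obtain ⟨D, hD, hD'⟩ : ∃ D, (∀ n, ∀ f : Fin (D + 1) → A, (∀ i, f i ∈ V n) →
      ¬ LeafIndependent k w f) ∧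
      ∃ n₀, ∃ u : Fin D → A, (∀ i, u i ∈ V n₀) ∧ LeafIndependent k w u := by
    classical
    have hex : ∃ D, ∀ n, ∀ f : Fin (D + 1) → A, (∀ i, f i ∈ V n) → ¬ LeafIndependent k w f :=
      ⟨r, fun n f _ => hr f⟩
    refine ⟨Nat.find hex, Nat.find_spec hex, ?_⟩
    rcases h : Nat.find hex with _ | D
    · exact ⟨0, Fin.elim0, fun i => i.elim0, 1, one_ne_zero,
        fun c hc => (hc (Subsingleton.elim _ _)).elim⟩
    · have := Nat.find_min hex (m := D) (by omega)
      push Not at this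
      exact this
  have hlim := tendsto_finrank_div_pow hν hι hV1 hVmul hcov hb hspan hD hD'
  have hle : κ ≤ d := by
    obtain ⟨f, hf, hind⟩ := hκ1
    refine le_of_tendsto_finrank_div_pow hV1 hVmul (fun n hn => (finite_and_finrank_le hν hcov hD
      (IsGradedSemigroup.finite hb hn)).1) (f := f) (fun l => ?_) hind hlim
    obtain ⟨n, hn, hfn⟩ := hf l
    obtain ⟨q, rfl⟩ := hdvd n fun h => hind.ne_zero l (by rwa [h, Submodule.mem_bot] at hfn)
    exact ⟨q, Nat.pos_of_mul_pos_left hn, by simpa only [V, mul_comm] using hfn⟩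
  have hge : d ≤ κ := by
    by_contra! hlt
    obtain ⟨f, hf, hind⟩ := exists_algebraicIndependent_of_span_eq_top 𝒜 hm
      (fun n => hL (n * m)) hν hι hspan
    have hκd : κ + 2 ≤ d + 1 := by omega
    refine hκ2 ⟨fun l => f (Fin.castLE hκd l), fun l => ?_,
      hind.comp _ (Fin.castLE_injective hκd)⟩
    obtain ⟨n, hn, hfn⟩ := hf (Fin.castLE hκd l)
    exact ⟨n * m, Nat.mul_pos hn hm, hfn⟩
  obtain rfl : d = κ := le_antisymm hge hle
  obtain ⟨p₀, c, hc, hclim⟩ := exists_tendsto_finrank_subfamilies hν hι hV1 hVmul hcov hb hspan hD hD'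
    (W := fun p n => Subalgebra.toSubmodule (Algebra.adjoin k (L (p * m) : Set A))
      ⊓ 𝒜 (n * (p * m)))
    (fun p => ⟨(Algebra.adjoin k (L (p * m) : Set A)).one_mem, by simpa using SetLike.GradedOne.one_mem (A := 𝒜)⟩)
    (fun p i j x hx y hy => ⟨(Algebra.adjoin k (L (p * m) : Set A)).mul_mem hx.1 hy.1, by
      rw [add_mul]; exact SetLike.GradedMul.mul_mem hx.2 hy.2⟩)
    (fun p n => by
      simpa only [V, mul_assoc] using adjoin_inf_le 𝒜 hL hL1 hLmul (p * m) (n * (p * m)))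
    (fun p x hx => ⟨Algebra.subset_adjoin hx, by simpa using hL _ hx⟩)
  exact ⟨p₀, c, _, hc, hlim, hclim⟩
end

section
/- Let k be a field and A a finite-dimensional commutative local k-algebra which is not reduced (so Spec(A) is a zero-dimensional irreducible nonreduced k-scheme), and let L = ⊕_{n≥0} L_n be a graded linear series on Spec(A) with Kodaira–Iitaka dimension κ(L) = 0. Then there exists a positive integer r such that for every positive integer a the limit lim_{n→∞} dim_k L_{a+nr} exists. -/
open Filter Topology

open Polynomial in
/-- The homogeneous elements of degree `n` in `A[X]`, as the image of `A` under `a ↦ a X ^ n`. -/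
theorem le_range_monomial {k A : Type*} [Field k] [CommRing A] [Algebra k A] {n : ℕ}
    {V : Submodule k A[X]} (hV : ∀ x ∈ V, ∃ a : A, x = C a * X ^ n) :
    V ≤ LinearMap.range ((monomial n : A →ₗ[A] A[X]).restrictScalars k) := by
  intro x hx
  obtain ⟨a, rfl⟩ := hV x hx
  exact ⟨a, (C_mul_X_pow_eq_monomial).symm⟩

/-- In an Artinian local ring every non-nilpotent element is a unit. -/
theorem isUnit_of_not_isNilpotent {A : Type*} [CommRing A] [IsArtinianRing A] [IsLocalRing A]
    {u : A} (hu : ¬ IsNilpotent u) : IsUnit u := by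
  by_contra h
  obtain ⟨n, hn⟩ := IsArtinianRing.isNilpotent_jacobson_bot (R := A)
  rw [IsLocalRing.jacobson_eq_maximalIdeal ⊥ bot_ne_top] at hn
  refine hu ⟨n, ?_⟩
  have := Ideal.pow_mem_pow ((IsLocalRing.mem_maximalIdeal u).2 h) n
  rwa [hn] at this

/-- A bounded monotone sequence of natural numbers converges after casting to `ℝ`. -/
theorem exists_tendsto_natCast_of_monotone {u : ℕ → ℕ} (hu : Monotone u) {b : ℕ}
    (hb : ∀ n, u n ≤ b) : ∃ c : ℝ, Tendsto (fun n => (u n : ℝ)) atTop (𝓝 c) :=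
  ⟨_, tendsto_atTop_ciSup (fun _ _ h => Nat.cast_le.2 (hu h))
    ⟨b, by rintro _ ⟨n, rfl⟩; exact Nat.cast_le.2 (hb n)⟩⟩

/-- Let `k` be a field and `A` a finite-dimensional commutative local `k`-algebra which is not
reduced (so `Spec A` is a zero-dimensional irreducible nonreduced `k`-scheme), and let
`L = ⊕_{n≥0} L_n` be a graded linear series on `Spec A`, i.e. a graded `k`-subalgebra of
`A[t]` with `L_n ⊆ A·t^n`, of Kodaira–Iitaka dimension `κ(L) = 0` (some homogeneous element
of positive degree is algebraically independent over `k`, but no two such elements are).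
Then there is a positive integer `r` such that for every positive integer `a` the limit
`lim_{n→∞} dim_k L_{a+nr}` exists. -/
theorem statement17 (k : Type*) [Field k] (A : Type*) [CommRing A] [Algebra k A]
    [FiniteDimensional k A] [IsLocalRing A] (hnr : ¬ IsReduced A)
    (L : ℕ → Submodule k (Polynomial A))
    (hdeg : ∀ n, ∀ x ∈ L n, ∃ a : A, x = Polynomial.C a * Polynomial.X ^ n)
    (h1 : (1 : Polynomial A) ∈ L 0)
    (hmul : ∀ i j, ∀ x ∈ L i, ∀ y ∈ L j, x * y ∈ L (i + j))
    (hκpos : ∃ f : Fin 1 → Polynomial A,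
      (∀ l, ∃ n, 0 < n ∧ f l ∈ L n) ∧ AlgebraicIndependent k f)
    (hκle : ¬ ∃ f : Fin 2 → Polynomial A,
      (∀ l, ∃ n, 0 < n ∧ f l ∈ L n) ∧ AlgebraicIndependent k f) :
    ∃ r : ℕ, 0 < r ∧ ∀ a : ℕ, 0 < a →
      ∃ c : ℝ, Tendsto (fun n : ℕ => (Module.finrank k ↥(L (a + n * r)) : ℝ)) atTop (𝓝 c) := by
  obtain ⟨f, hf, hind⟩ := hκpos
  obtain ⟨r, hr, hfr⟩ := hf 0
  obtain ⟨u, hu⟩ := hdeg r _ hfr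
  have : IsArtinianRing A := IsArtinianRing.of_finite k A
  have htr : Transcendental k (f 0) := hind.transcendental 0
  have hunit : IsUnit u := by
    refine isUnit_of_not_isNilpotent fun ⟨n, hn⟩ => htr ?_
    refine ⟨Polynomial.X ^ n, pow_ne_zero n Polynomial.X_ne_zero, ?_⟩
    rw [map_pow, Polynomial.aeval_X, hu, mul_pow, ← map_pow, hn, map_zero, zero_mul]
  have hreg : IsLeftRegular (f 0) := by
    rw [hu]
    exact (hunit.map Polynomial.C).isRegular.left.mul (Polynomial.monic_X_pow r).isRegular.left
  have hle (n : ℕ) := le_range_monomial (hdeg n)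
  have hfin (n : ℕ) : FiniteDimensional k (L n) := Submodule.finiteDimensional_of_le (hle n)
  refine ⟨r, hr, fun a _ => exists_tendsto_natCast_of_monotone (b := Module.finrank k A)
    (monotone_nat_of_le_succ fun n => ?_)
    fun n => (Submodule.finrank_mono (hle _)).trans (LinearMap.finrank_range_le _)⟩
  have hmaps : ∀ x ∈ L (a + n * r), LinearMap.mulLeft k (f 0) x ∈ L (a + (n + 1) * r) := by
    intro x hx
    have := hmul _ _ _ hfr x hx
    rwa [show r + (a + n * r) = a + (n + 1) * r by ring] at this
  refine LinearMap.finrank_le_finrank_of_injective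
    (f := (LinearMap.mulLeft k (f 0)).restrict hmaps) fun x y hxy => Subtype.ext (hreg ?_)
  exact congrArg Subtype.val hxy
end

section
/- Let k be a field and A a finite-dimensional commutative k-algebra which is not reduced. Then there exists a graded linear series L = ⊕_{n≥0} L_n on Spec(A) with Kodaira–Iitaka dimension κ(L) = −∞ such that for every a ∈ ℕ and every integer r ≥ 1 the limit lim_{n→∞} dim_k L_{a+nr} does not exist; i.e., the limit fails along every arithmetic sequence. -/
open Filter Topology

/-- Every arithmetic progression frequently visits dyadic blocks of both parities. -/
theorem frequently_even_log_iff (p : Prop) (a r : ℕ) (hr : 1 ≤ r) :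
    ∃ᶠ n in atTop, 0 < a + n * r ∧ (Even (Nat.log 2 (a + n * r)) ↔ p) := by
  rw [frequently_atTop]
  intro N
  obtain ⟨j, hj, hjp⟩ : ∃ j, a + r * (N + 1) < 2 ^ j ∧ (Even j ↔ p) := by
    have hlt : a + r * (N + 1) < 2 ^ (a + r * (N + 1)) := Nat.lt_two_pow_self
    by_cases h : Even (a + r * (N + 1)) ↔ p
    · exact ⟨_, hlt, h⟩
    · refine ⟨a + r * (N + 1) + 1, ?_, ?_⟩
      · rw [pow_succ]
        omega
      · rw [Nat.even_add_one]
        tauto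
  have hdiv := Nat.div_add_mod (2 ^ j - a) r
  have hmod := Nat.mod_lt (2 ^ j - a) hr
  have hN : N + 1 ≤ (2 ^ j - a) / r := by
    rw [Nat.le_div_iff_mul_le hr, mul_comm]
    omega
  have hrN : r ≤ r * (N + 1) := Nat.le_mul_of_pos_right r N.succ_pos
  have hval : a + ((2 ^ j - a) / r + 1) * r = a + r * ((2 ^ j - a) / r) + r := by ring
  refine ⟨(2 ^ j - a) / r + 1, by omega, by rw [hval]; omega, ?_⟩
  have hlog : Nat.log 2 (a + ((2 ^ j - a) / r + 1) * r) = j := by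
    rw [hval]
    exact Nat.log_eq_of_pow_le_of_lt_pow (by omega) (by rw [pow_succ]; omega)
  rwa [hlog]

/-- A nonzero ring element of square zero exists in any ring that is not reduced. -/
theorem exists_ne_zero_mul_self_eq_zero {A : Type*} [CommRing A] (h : ¬ IsReduced A) :
    ∃ e : A, e ≠ 0 ∧ e * e = 0 := by
  by_contra! hc
  refine h ((isReduced_iff_pow_one_lt 2 one_lt_two).2 fun x hx => ?_)
  by_contra hx0
  exact hc x hx0 (by rwa [← sq])

/-- The graded linear series with `k` in degree zero and, in positive degree `n`, the line
spanned by `e * X ^ n` if `Nat.log 2 n` is even, and zero otherwise. -/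
noncomputable def dyadicSeries (k : Type*) [Field k] {A : Type*} [CommRing A] [Algebra k A]
    (e : A) (n : ℕ) : Submodule k (Polynomial A) :=
  if n = 0 then k ∙ 1
  else if Even (Nat.log 2 n) then k ∙ (Polynomial.C e * Polynomial.X ^ n) else ⊥

section dyadicSeries

variable {k : Type*} [Field k] {A : Type*} [CommRing A] [Algebra k A] {e : A}

theorem mem_dyadicSeries_zero {x : Polynomial A} :
    x ∈ dyadicSeries k e 0 ↔ ∃ c : k, x = c • 1 := by
  simp [dyadicSeries, Submodule.mem_span_singleton, eq_comm]

theorem exists_eq_smul_of_mem_dyadicSeries {n : ℕ} (hn : n ≠ 0) {x : Polynomial A}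
    (hx : x ∈ dyadicSeries k e n) :
    ∃ c : k, x = c • (Polynomial.C e * Polynomial.X ^ n) := by
  rw [dyadicSeries, if_neg hn] at hx
  split_ifs at hx
  · obtain ⟨c, rfl⟩ := Submodule.mem_span_singleton.1 hx
    exact ⟨c, rfl⟩
  · exact ⟨0, by simpa using hx⟩

theorem mul_eq_zero_of_mem_dyadicSeries (he : e * e = 0) {i j : ℕ} (hi : i ≠ 0) (hj : j ≠ 0)
    {x y : Polynomial A} (hx : x ∈ dyadicSeries k e i) (hy : y ∈ dyadicSeries k e j) :
    x * y = 0 := by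
  obtain ⟨c, rfl⟩ := exists_eq_smul_of_mem_dyadicSeries hi hx
  obtain ⟨d, rfl⟩ := exists_eq_smul_of_mem_dyadicSeries hj hy
  rw [smul_mul_smul_comm, mul_mul_mul_comm, ← Polynomial.C_mul, he]
  simp

theorem mul_mem_dyadicSeries (he : e * e = 0) {i j : ℕ} {x y : Polynomial A}
    (hx : x ∈ dyadicSeries k e i) (hy : y ∈ dyadicSeries k e j) :
    x * y ∈ dyadicSeries k e (i + j) := by
  rcases eq_or_ne i 0 with rfl | hi
  · obtain ⟨c, rfl⟩ := mem_dyadicSeries_zero.1 hx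
    rw [smul_one_mul, zero_add]
    exact Submodule.smul_mem _ c hy
  rcases eq_or_ne j 0 with rfl | hj
  · obtain ⟨c, rfl⟩ := mem_dyadicSeries_zero.1 hy
    rw [mul_smul_one, add_zero]
    exact Submodule.smul_mem _ c hx
  rw [mul_eq_zero_of_mem_dyadicSeries he hi hj hx hy]
  exact Submodule.zero_mem _

theorem finrank_dyadicSeries_of_even (he : e ≠ 0) {n : ℕ} (hn : n ≠ 0)
    (h : Even (Nat.log 2 n)) : Module.finrank k ↥(dyadicSeries k e n) = 1 := by
  rw [dyadicSeries, if_neg hn, if_pos h]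
  refine finrank_span_singleton ?_
  rwa [Polynomial.C_mul_X_pow_eq_monomial, Ne, Polynomial.monomial_eq_zero_iff]

theorem finrank_dyadicSeries_of_not_even {n : ℕ} (hn : n ≠ 0)
    (h : ¬ Even (Nat.log 2 n)) : Module.finrank k ↥(dyadicSeries k e n) = 0 := by
  rw [dyadicSeries, if_neg hn, if_neg h, finrank_bot]

end dyadicSeries

/-- Let `k` be a field and `A` a nonzero finite-dimensional commutative `k`-algebra which is
not reduced.  Then there is a graded linear series `L = ⊕_{n≥0} L_n` on `Spec A` (a graded
`k`-subalgebra of `A[t]` with `L_n ⊆ A·t^n`) of Kodaira–Iitaka dimension `κ(L) = -∞` (no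
homogeneous element of positive degree is algebraically independent over `k`) such that for
every `a ∈ ℕ` and every `r ≥ 1` the limit `lim_{n→∞} dim_k L_{a+nr}` does not exist. -/
theorem statement18 (k : Type*) [Field k] (A : Type*) [CommRing A] [Algebra k A]
    [FiniteDimensional k A] [Nontrivial A] (hnr : ¬ IsReduced A) :
    ∃ L : ℕ → Submodule k (Polynomial A),
      (∀ n, ∀ x ∈ L n, ∃ a : A, x = Polynomial.C a * Polynomial.X ^ n) ∧
      (1 : Polynomial A) ∈ L 0 ∧
      (∀ i j, ∀ x ∈ L i, ∀ y ∈ L j, x * y ∈ L (i + j)) ∧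
      (¬ ∃ f : Fin 1 → Polynomial A,
        (∀ l, ∃ n, 0 < n ∧ f l ∈ L n) ∧ AlgebraicIndependent k f) ∧
      ∀ a r : ℕ, 1 ≤ r →
        ¬ ∃ c : ℝ, Tendsto (fun n : ℕ => (Module.finrank k ↥(L (a + n * r)) : ℝ))
            atTop (𝓝 c) := by
  obtain ⟨e, he, hee⟩ := exists_ne_zero_mul_self_eq_zero hnr
  refine ⟨dyadicSeries k e, ?_, mem_dyadicSeries_zero.2 ⟨1, (one_smul k _).symm⟩,
    fun i j x hx y hy => mul_mem_dyadicSeries hee hx hy, ?_, ?_⟩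
  · intro n x hx
    rcases eq_or_ne n 0 with rfl | hn
    · obtain ⟨c, rfl⟩ := mem_dyadicSeries_zero.1 hx
      exact ⟨c • 1, by rw [← Polynomial.smul_C]; simp⟩
    · obtain ⟨c, rfl⟩ := exists_eq_smul_of_mem_dyadicSeries hn hx
      exact ⟨c • e, by rw [← Polynomial.smul_C, smul_mul_assoc]⟩
  · rintro ⟨f, hf, hind⟩
    obtain ⟨n, hn, hfn⟩ := hf 0
    have hsq := mul_eq_zero_of_mem_dyadicSeries hee hn.ne' hn.ne' hfn hfn
    have hX : (MvPolynomial.X 0 * MvPolynomial.X 0 : MvPolynomial (Fin 1) k) = 0 :=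
      hind.eq_zero_of_aeval_eq_zero _ (by simpa using hsq)
    exact MvPolynomial.X_ne_zero 0 (mul_self_eq_zero.1 hX)
  · rintro a r hr ⟨c, hc⟩
    have h1 : c ∈ ({1} : Set ℝ) := isClosed_singleton.mem_of_frequently_of_tendsto
      ((frequently_even_log_iff True a r hr).mono fun n hn => by
        simp [finrank_dyadicSeries_of_even he hn.1.ne' (hn.2.2 trivial)]) hc
    have h0 : c ∈ ({0} : Set ℝ) := isClosed_singleton.mem_of_frequently_of_tendsto
      ((frequently_even_log_iff False a r hr).mono fun n hn => by
        simp [finrank_dyadicSeries_of_not_even (k := k) (e := e) hn.1.ne' hn.2.1]) hc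
    exact one_ne_zero (h1.symm.trans h0)
end

section
/- Let k be a field and A a finite-dimensional commutative k-algebra which is not reduced and has at least two maximal ideals (so Spec(A) is a zero-dimensional nonirreducible nonreduced k-scheme). Then there exists a graded linear series L = ⊕_{n≥0} L_n on Spec(A) with Kodaira–Iitaka dimension κ(L) = 0 such that for every a ∈ ℕ and every integer r ≥ 1 the limit lim_{n→∞} dim_k L_{a+nr} does not exist; i.e., the limit fails along every arithmetic sequence. -/
open Filter Topology

/-- Every sufficiently large number is the integer square root of arbitrarily late terms of a
given arithmetic progression. -/
theorem Nat.exists_sqrt_add_mul_eq {a r N s : ℕ} (hr : 1 ≤ r) (hs : a + N * r + r ≤ s) :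
    ∃ m, N ≤ m ∧ Nat.sqrt (a + m * r) = s := by
  have hss : s ≤ s * s := Nat.le_mul_self s
  have hdiv := Nat.div_add_mod (s * s - a) r
  have hmod := Nat.mod_lt (s * s - a) hr
  have key : ((s * s - a) / r + 1) * r = r * ((s * s - a) / r) + r := by ring
  refine ⟨(s * s - a) / r + 1, ?_, ?_⟩
  · refine Nat.le_of_mul_le_mul_right (c := r) ?_ hr
    rw [key]
    omega
  · rw [key]
    refine (Nat.eq_sqrt.mpr ⟨by omega, ?_⟩).symm
    have : (s + 1) * (s + 1) = s * s + 2 * s + 1 := by ring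
    omega

/-- An Artinian ring with two distinct maximal ideals has a nontrivial idempotent. -/
theorem IsArtinianRing.exists_isIdempotentElem_ne {A : Type*} [CommRing A] [IsArtinianRing A]
    {m₁ m₂ : Ideal A} (h₁ : m₁.IsMaximal) (h₂ : m₂.IsMaximal) (hne : m₁ ≠ m₂) :
    ∃ e : A, e * e = e ∧ e ≠ 0 ∧ e ≠ 1 := by
  obtain ⟨a, ha₁, ha₂⟩ : ∃ a ∈ m₁, a ∉ m₂ := by
    by_contra! h
    exact hne (h₁.eq_of_le h₂.ne_top h)
  obtain ⟨n, y, hy⟩ := IsArtinian.exists_pow_succ_smul_dvd a (1 : A)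
  simp only [smul_eq_mul, mul_one] at hy
  have hpow : ∀ j, a ^ n * (a * y) ^ j = a ^ n := by
    intro j
    induction j with
    | zero => simp
    | succ j ih =>
      calc a ^ n * (a * y) ^ (j + 1) = (a ^ n * (a * y) ^ j) * (a * y) := by ring
        _ = a ^ n.succ * y := by rw [ih, Nat.succ_eq_add_one]; ring
        _ = a ^ n := hy
  have he : a ^ n * (a * y) ^ (n + 1) = a ^ n := hpow (n + 1)
  refine ⟨(a * y) ^ (n + 1), ?_, ?_, ?_⟩
  · calc (a * y) ^ (n + 1) * (a * y) ^ (n + 1)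
        = (a ^ n * (a * y) ^ (n + 1)) * (a * y ^ (n + 1)) := by ring
      _ = (a * y) ^ (n + 1) := by rw [he]; ring
  · intro h0
    rw [h0, mul_zero] at he
    exact ha₂ (h₂.isPrime.mem_of_pow_mem n (he ▸ m₂.zero_mem))
  · intro h1
    refine h₁.ne_top ((Ideal.eq_top_iff_one _).mpr ?_)
    rw [← h1]
    exact m₁.pow_mem_of_mem (m₁.mul_mem_right y ha₁) _ n.succ_pos

/-- A nonreduced ring with a nontrivial idempotent has a nonzero idempotent annihilating a
nonzero element of square zero. -/
theorem exists_isIdempotentElem_mul_eq_zero {A : Type*} [CommRing A] (hnr : ¬ IsReduced A)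
    (h : ∃ e : A, e * e = e ∧ e ≠ 0 ∧ e ≠ 1) :
    ∃ e x : A, e * e = e ∧ e ≠ 0 ∧ x ≠ 0 ∧ x * x = 0 ∧ e * x = 0 := by
  obtain ⟨e, hee, he0, he1⟩ := h
  rw [isReduced_iff_pow_one_lt 2 one_lt_two] at hnr
  push Not at hnr
  obtain ⟨x, hx2, hx0⟩ := hnr
  by_cases hex : e * x = 0
  · exact ⟨e, x, hee, he0, hx0, by rw [← sq, hx2], hex⟩
  · refine ⟨1 - e, e * x, by linear_combination hee, sub_ne_zero.mpr he1.symm, hex, ?_, ?_⟩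
    · linear_combination e ^ 2 * hx2
    · linear_combination -x * hee

section GradedPieces

variable (k : Type*) [Field k] {A : Type*} [CommRing A] [Algebra k A]

open Classical in
/-- The coefficient spaces: constants in degree `0`, and in positive degree `n` the span of `e`,
enlarged by `x` when `⌊√n⌋` is even. -/
noncomputable def coeffSpace (e x : A) (n : ℕ) : Submodule k A :=
  if n = 0 then Submodule.span k {1}
  else if Even n.sqrt then Submodule.span k {e, x} else Submodule.span k {e}

/-- The graded linear series with coefficient spaces `coeffSpace k e x n`. -/
noncomputable def oscillatingSeries (e x : A) (n : ℕ) : Submodule k (Polynomial A) :=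
  (coeffSpace k e x n).map ((Polynomial.monomial n : A →ₗ[A] Polynomial A).restrictScalars k)

variable {k} {e x : A} {n : ℕ}

theorem mem_oscillatingSeries {p : Polynomial A} :
    p ∈ oscillatingSeries k e x n ↔ ∃ v ∈ coeffSpace k e x n, Polynomial.monomial n v = p :=
  Iff.rfl

theorem span_singleton_le_coeffSpace (hn : n ≠ 0) :
    Submodule.span k {e} ≤ coeffSpace k e x n := by
  rw [coeffSpace, if_neg hn]
  split_ifs
  · exact Submodule.span_mono (by simp)
  · exact le_rfl

theorem exists_of_mem_coeffSpace (hn : n ≠ 0) {v : A} (hv : v ∈ coeffSpace k e x n) :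
    ∃ α β : k, α • e + β • x = v := by
  rw [coeffSpace, if_neg hn] at hv
  split_ifs at hv
  · exact Submodule.mem_span_pair.mp hv
  · obtain ⟨α, rfl⟩ := Submodule.mem_span_singleton.mp hv
    exact ⟨α, 0, by simp⟩

theorem mul_mem_coeffSpace (hee : e * e = e) (hxx : x * x = 0) (hex : e * x = 0) {i j : ℕ}
    {u v : A} (hu : u ∈ coeffSpace k e x i) (hv : v ∈ coeffSpace k e x j) :
    u * v ∈ coeffSpace k e x (i + j) := by
  rcases eq_or_ne i 0 with rfl | hi
  · obtain ⟨α, rfl⟩ := Submodule.mem_span_singleton.mp (by simpa [coeffSpace] using hu)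
    rw [zero_add, smul_mul_assoc, one_mul]
    exact Submodule.smul_mem _ _ hv
  rcases eq_or_ne j 0 with rfl | hj
  · obtain ⟨α, rfl⟩ := Submodule.mem_span_singleton.mp (by simpa [coeffSpace] using hv)
    rw [add_zero, mul_smul_comm, mul_one]
    exact Submodule.smul_mem _ _ hu
  obtain ⟨α, β, rfl⟩ := exists_of_mem_coeffSpace hi hu
  obtain ⟨γ, δ, rfl⟩ := exists_of_mem_coeffSpace hj hv
  refine span_singleton_le_coeffSpace (by omega) (Submodule.mem_span_singleton.mpr ⟨α * γ, ?_⟩)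
  simp [add_mul, mul_add, smul_smul, hee, hxx, hex, mul_comm x e, mul_comm γ α]

theorem finrank_oscillatingSeries :
    Module.finrank k (oscillatingSeries k e x n) = Module.finrank k (coeffSpace k e x n) :=
  LinearEquiv.finrank_eq (Submodule.equivMapOfInjective
    ((Polynomial.monomial n : A →ₗ[A] Polynomial A).restrictScalars k)
    (Polynomial.monomial_injective n) _).symm

theorem finrank_coeffSpace_of_not_even (he : e ≠ 0) (hn : ¬ Even n.sqrt) :
    Module.finrank k (coeffSpace k e x n) = 1 := by
  have hn0 : n ≠ 0 := by rintro rfl; simp at hn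
  rw [coeffSpace, if_neg hn0, if_neg hn, finrank_span_singleton he]

theorem finrank_coeffSpace_of_even (hee : e * e = e) (he : e ≠ 0) (hx : x ≠ 0)
    (hex : e * x = 0) (hn0 : n ≠ 0) (hn : Even n.sqrt) :
    Module.finrank k (coeffSpace k e x n) = 2 := by
  have hli : LinearIndependent k ![e, x] := by
    refine LinearIndependent.pair_iff.mpr fun α β h => ?_
    have hα : α = 0 := by
      have : e * (α • e + β • x) = 0 := by rw [h, mul_zero]
      simpa [mul_add, hee, hex, he] using this
    subst hα
    simpa [hx] using h
  have := finrank_span_eq_card hli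
  rw [coeffSpace, if_neg hn0, if_pos hn]
  rwa [Fintype.card_fin, Matrix.range_cons_cons_empty] at this

theorem not_tendsto_finrank_oscillatingSeries (hee : e * e = e) (he : e ≠ 0) (hx : x ≠ 0)
    (hex : e * x = 0) (a : ℕ) {r : ℕ} (hr : 1 ≤ r) (c : ℝ) :
    ¬ Tendsto (fun n : ℕ => (Module.finrank k (oscillatingSeries k e x (a + n * r)) : ℝ))
      atTop (𝓝 c) := by
  intro h
  obtain ⟨N, hN⟩ := Metric.tendsto_atTop.mp h (1 / 2) (by norm_num)
  obtain ⟨m, hm, hms⟩ :=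
    Nat.exists_sqrt_add_mul_eq (a := a) (N := N) (s := 2 * (a + N * r + r)) hr (by omega)
  obtain ⟨l, hl, hls⟩ :=
    Nat.exists_sqrt_add_mul_eq (a := a) (N := N) (s := 2 * (a + N * r + r) + 1) hr (by omega)
  have hm0 : a + m * r ≠ 0 := by
    intro h0
    rw [h0, Nat.sqrt_zero] at hms
    omega
  have h2 := hN m hm
  have h1 := hN l hl
  rw [finrank_oscillatingSeries,
    finrank_coeffSpace_of_even hee he hx hex hm0 (by rw [hms]; exact even_two_mul _)] at h2
  rw [finrank_oscillatingSeries,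
    finrank_coeffSpace_of_not_even he (by rw [hls]; simp)] at h1
  rw [Real.dist_eq, abs_lt] at h1 h2
  push_cast at h1 h2
  linarith [h1.1, h1.2, h2.1, h2.2]

theorem transcendental_C_mul_X (hee : e * e = e) (he : e ≠ 0) :
    Transcendental k (Polynomial.C e * Polynomial.X) := by
  rw [transcendental_iff]
  intro p hp
  have hcomp : (p.map (algebraMap k A)).comp (Polynomial.C e * Polynomial.X) = 0 := by
    rw [← hp, Polynomial.comp, Polynomial.eval₂_map, Polynomial.aeval_def]
    rfl
  ext i
  have hi := congrArg (fun q => e * Polynomial.coeff q i) hcomp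
  have hei : e * e ^ i = e := by
    rw [← pow_succ']
    exact IsIdempotentElem.pow_succ_eq i hee
  simp only [Polynomial.comp_C_mul_X_coeff, Polynomial.coeff_map, Polynomial.coeff_zero,
    mul_zero, mul_left_comm e, hei] at hi
  rw [← Algebra.smul_def] at hi
  simpa [he] using hi

theorem exists_sq_of_mem_oscillatingSeries (hee : e * e = e) (hxx : x * x = 0)
    (hex : e * x = 0) (hn : n ≠ 0) {p : Polynomial A} (hp : p ∈ oscillatingSeries k e x n) :
    ∃ α : k, p ^ 2 = α • (Polynomial.C e * Polynomial.X ^ (2 * n)) := by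
  obtain ⟨v, hv, rfl⟩ := mem_oscillatingSeries.mp hp
  obtain ⟨α, β, rfl⟩ := exists_of_mem_coeffSpace hn hv
  refine ⟨α ^ 2, ?_⟩
  rw [Polynomial.monomial_pow, Polynomial.C_mul_X_pow_eq_monomial, Polynomial.smul_monomial,
    mul_comm n]
  congr 1
  simp [sq, add_mul, mul_add, smul_smul, hee, hxx, hex, mul_comm x e]

theorem not_algebraicIndependent_of_mem_oscillatingSeries (hee : e * e = e) (hxx : x * x = 0)
    (hex : e * x = 0) {f : Fin 2 → Polynomial A}
    (hf : ∀ l, ∃ n, 0 < n ∧ f l ∈ oscillatingSeries k e x n) : ¬ AlgebraicIndependent k f := by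
  intro h
  obtain ⟨n, hn, hfn⟩ := hf 0
  obtain ⟨m, hm, hfm⟩ := hf 1
  obtain ⟨α, hα⟩ := exists_sq_of_mem_oscillatingSeries hee hxx hex hn.ne' hfn
  obtain ⟨β, hβ⟩ := exists_sq_of_mem_oscillatingSeries hee hxx hex hm.ne' hfm
  have hpow : ∀ j : ℕ, 0 < j → (Polynomial.C e : Polynomial A) ^ j = Polynomial.C e := by
    intro j hj
    obtain ⟨i, rfl⟩ := Nat.exists_eq_succ_of_ne_zero hj.ne'
    rw [← Polynomial.C_pow, Nat.succ_eq_add_one, IsIdempotentElem.pow_succ_eq i hee]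
  have h0 : (f 0 ^ 2) ^ m = α ^ m • (Polynomial.C e * Polynomial.X ^ (2 * n * m)) := by
    rw [hα, smul_pow, mul_pow, hpow m hm, ← pow_mul]
  have h1 : (f 1 ^ 2) ^ n = β ^ n • (Polynomial.C e * Polynomial.X ^ (2 * n * m)) := by
    rw [hβ, smul_pow, mul_pow, hpow n hn, ← pow_mul, mul_right_comm]
  have hrel : β ^ n • ((MvPolynomial.X 0 : MvPolynomial (Fin 2) k) ^ 2) ^ m =
      α ^ m • (MvPolynomial.X 1 ^ 2) ^ n := by
    apply h
    simp only [map_smul, map_pow, MvPolynomial.aeval_X, h0, h1]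
    exact smul_comm _ _ _
  have hα0 : α = 0 := by
    have := congrArg (MvPolynomial.eval ![(0 : k), 1]) hrel
    exact pow_eq_zero_iff hm.ne' |>.mp
      (by simpa [MvPolynomial.smul_eval, hm.ne'] using this.symm)
  have hsq : (MvPolynomial.X 0 : MvPolynomial (Fin 2) k) ^ 2 = 0 := by
    apply h
    simp [hα, hα0]
  exact MvPolynomial.X_ne_zero 0 (pow_eq_zero_iff two_ne_zero |>.mp hsq)

end GradedPieces

/-- Let `k` be a field and `A` a finite-dimensional commutative `k`-algebra which is not
reduced and has at least two maximal ideals (so `Spec A` is a zero-dimensional nonirreducible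
nonreduced `k`-scheme).  Then there is a graded linear series `L = ⊕_{n≥0} L_n` on `Spec A`
(a graded `k`-subalgebra of `A[t]` with `L_n ⊆ A·t^n`) of Kodaira–Iitaka dimension
`κ(L) = 0` such that for every `a ∈ ℕ` and every `r ≥ 1` the limit
`lim_{n→∞} dim_k L_{a+nr}` does not exist. -/
theorem statement19 (k : Type*) [Field k] (A : Type*) [CommRing A] [Algebra k A]
    [FiniteDimensional k A] [Nontrivial A] (hnr : ¬ IsReduced A)
    (hmax : ∃ m₁ m₂ : Ideal A, m₁.IsMaximal ∧ m₂.IsMaximal ∧ m₁ ≠ m₂) :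
    ∃ L : ℕ → Submodule k (Polynomial A),
      (∀ n, ∀ x ∈ L n, ∃ a : A, x = Polynomial.C a * Polynomial.X ^ n) ∧
      (1 : Polynomial A) ∈ L 0 ∧
      (∀ i j, ∀ x ∈ L i, ∀ y ∈ L j, x * y ∈ L (i + j)) ∧
      (∃ f : Fin 1 → Polynomial A,
        (∀ l, ∃ n, 0 < n ∧ f l ∈ L n) ∧ AlgebraicIndependent k f) ∧
      (¬ ∃ f : Fin 2 → Polynomial A,
        (∀ l, ∃ n, 0 < n ∧ f l ∈ L n) ∧ AlgebraicIndependent k f) ∧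
      ∀ a r : ℕ, 1 ≤ r →
        ¬ ∃ c : ℝ, Tendsto (fun n : ℕ => (Module.finrank k ↥(L (a + n * r)) : ℝ))
            atTop (𝓝 c) := by
  have : IsArtinianRing A := IsArtinianRing.of_finite k A
  obtain ⟨m₁, m₂, h₁, h₂, hne⟩ := hmax
  obtain ⟨e, x, hee, he, hx, hxx, hex⟩ := exists_isIdempotentElem_mul_eq_zero hnr
    (IsArtinianRing.exists_isIdempotentElem_ne h₁ h₂ hne)
  refine ⟨oscillatingSeries k e x, ?_, ?_, ?_, ?_, ?_, ?_⟩
  · rintro n _ ⟨v, -, rfl⟩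
    exact ⟨v, (Polynomial.C_mul_X_pow_eq_monomial).symm⟩
  · exact mem_oscillatingSeries.mpr
      ⟨1, by simp [coeffSpace], rfl⟩
  · rintro i j _ ⟨u, hu, rfl⟩ _ ⟨v, hv, rfl⟩
    exact mem_oscillatingSeries.mpr
      ⟨u * v, mul_mem_coeffSpace hee hxx hex hu hv, (Polynomial.monomial_mul_monomial i j u v).symm⟩
  · refine ⟨fun _ => Polynomial.C e * Polynomial.X, fun _ => ⟨1, one_pos, ?_⟩, ?_⟩
    · exact mem_oscillatingSeries.mpr
        ⟨e, span_singleton_le_coeffSpace one_ne_zero (Submodule.mem_span_singleton_self e),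
          Polynomial.C_mul_X_eq_monomial.symm⟩
    · rw [algebraicIndependent_unique_type_iff]
      exact transcendental_C_mul_X hee he
  · rintro ⟨f, hf, hind⟩
    exact not_algebraicIndependent_of_mem_oscillatingSeries hee hxx hex hf hind
  · rintro a r hr ⟨c, hc⟩
    exact not_tendsto_finrank_oscillatingSeries hee he hx hex a hr c hc
end
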